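/- arXiv:2508.17737 — 2 statements merged into one kernel-verified Lean document; each statement's English description precedes it below -/
import Mathlib

section
/- With the microlocal decomposition and the collection of bad functions as in the context, there is a constant C depending only on d (and the fixed functions φ, Φ) such that ‖ Σ_{j∈ℤ} Σ_v (I − G_v^s) T_j^v 𝔅_{j−s} ‖_{L³(ℝ^d)} ≤ C 2^{sγ((2/3)(d−1) + ⌊d/2⌋ + 1)} ‖Ω₂‖_∞ ( α² Σ_{Q∈𝔔} ‖b_Q‖_{L¹(ℝ^d)} )^{1/3}. -/
open MeasureTheory Metric Set FourierTransform
open scoped ENNReal RealInnerProductSpace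

noncomputable section

abbrev Rd (d : ℕ) : Type := EuclideanSpace ℝ (Fin d)

/-- Surface measure on the unit sphere `S^{d-1}`. -/
def sphereMeasure (d : ℕ) : Measure (sphere (0 : Rd d) 1) :=
  (volume : Measure (Rd d)).toSphere

/-- Integral over the sphere of a function defined on `ℝ^d`. -/
def sphInt (d : ℕ) (g : Rd d → ℝ) : ℝ :=
  ∫ θ : sphere (0 : Rd d) 1, g (θ : Rd d) ∂(sphereMeasure d)

/-- `‖Ω‖₁`, the `L¹(S^{d-1})` norm of `Ω`. -/
def omegaL1 (d : ℕ) (Ω : Rd d → ℝ) : ℝ := sphInt d (fun x => |Ω x|)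

/-- `‖Ω‖_{LlogL(S^{d-1})}`. -/
def omegaLlogL (d : ℕ) (Ω : Rd d → ℝ) : ℝ :=
  sphInt d (fun x => |Ω x| * Real.log (2 + |Ω x|))

/-- The constant `C_Ω`. -/
def constCOmega (d : ℕ) (Ω : Rd d → ℝ) : ℝ :=
  omegaLlogL d Ω +
    sphInt d (fun x => |Ω x| * (1 + max (Real.log (|Ω x| / omegaL1 d Ω)) 0))

/-- `Ω` is homogeneous of degree zero on `ℝ^d ∖ {0}`. -/
def Homogeneous0 (d : ℕ) (Ω : Rd d → ℝ) : Prop :=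
  ∀ x : Rd d, x ≠ 0 → ∀ r : ℝ, 0 < r → Ω (r • x) = Ω x

/-- The hypotheses on `Ω`: homogeneity of degree `0`, integrability on the sphere,
the cancellation condition, and `Ω ∈ L log L(S^{d-1})`. -/
def OmegaHyp (d : ℕ) (Ω : Rd d → ℝ) : Prop :=
  Homogeneous0 d Ω ∧
  Integrable (fun θ : sphere (0 : Rd d) 1 => Ω (θ : Rd d)) (sphereMeasure d) ∧
  (∫ θ : sphere (0 : Rd d) 1, Ω (θ : Rd d) ∂(sphereMeasure d)) = 0 ∧
  Integrable (fun θ : sphere (0 : Rd d) 1 => |Ω (θ : Rd d)| * Real.log (2 + |Ω (θ : Rd d)|))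
    (sphereMeasure d)

/-- `φ` is smooth, supported in the annulus `{2^{-4} < |x| < 2^{-2}}` and
satisfies the partition of unity condition `Σ_j φ(2^{-j} x) = 1` for `x ≠ 0`. -/
def AdmissiblePhi (d : ℕ) (φ : Rd d → ℝ) : Prop :=
  ContDiff ℝ (⊤ : ℕ∞) φ ∧
  tsupport φ ⊆ {x : Rd d | (2:ℝ) ^ (-4 : ℤ) < ‖x‖ ∧ ‖x‖ < (2:ℝ) ^ (-2 : ℤ)} ∧
  ∀ x : Rd d, x ≠ 0 → HasSum (fun j : ℤ => φ ((2:ℝ) ^ (-j) • x)) 1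

/-- The kernel `𝒦_j(x) = φ(2^{-j}x) Ω(x) |x|^{-d}`. -/
def Kker (d : ℕ) (φ Om : Rd d → ℝ) (j : ℤ) (x : Rd d) : ℝ :=
  φ ((2:ℝ) ^ (-j) • x) * Om x * ‖x‖ ^ (-(d : ℤ))

/-- The dyadic operator `T_j f = 𝒦_j * f`. -/
def Tj (d : ℕ) (φ Om : Rd d → ℝ) (j : ℤ) (f : Rd d → ℝ) (x : Rd d) : ℝ :=
  ∫ y, Kker d φ Om j (x - y) * f y

/-- The maximal dyadic truncated operator `T_* f(x) = sup_l |Σ_{j ≥ l} T_j f(x)|`. -/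
def TStar (d : ℕ) (φ Om f : Rd d → ℝ) (x : Rd d) : ℝ≥0∞ :=
  ⨆ l : ℤ, ENNReal.ofReal |∑' j : {j : ℤ // l ≤ j}, Tj d φ Om (j : ℤ) f x|

/-- The dyadic cube `2^k w + ∏_i [m_i 2^k, (m_i+1) 2^k)` in the shifted grid `𝔇^w`. -/
def dcube (d : ℕ) (w : Fin d → ℝ) (k : ℤ) (m : Fin d → ℤ) : Set (Rd d) :=
  {x | ∀ i : Fin d, (2:ℝ) ^ k * (w i + m i) ≤ x i ∧ x i < (2:ℝ) ^ k * (w i + m i + 1)}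

/-- The concentric cube `½K` of half the sidelength. -/
def dhalf (d : ℕ) (w : Fin d → ℝ) (k : ℤ) (m : Fin d → ℤ) : Set (Rd d) :=
  {x | ∀ i : Fin d,
    (2:ℝ) ^ k * (w i + m i + 1/4) ≤ x i ∧ x i < (2:ℝ) ^ k * (w i + m i + 3/4)}

/-- `w ∈ {0, 1/2}^d`. -/
def GridShift (d : ℕ) (w : Fin d → ℝ) : Prop := ∀ i, w i = 0 ∨ w i = 1/2

/-- The Calderón–Zygmund decomposition data at level `λ/C_Ω`: a countable collection
`Qset` of pairwise disjoint standard dyadic cubes and bad functions `b_Q` with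
`supp b_Q ⊆ Q`, `∫ b_Q = 0`, `‖b_Q‖₁ ≤ C⟨f⟩_Q |Q|` and `⟨f⟩_Q ≈ λ/C_Ω`. -/
structure CZData (d : ℕ) (COm Cc c₁ c₂ : ℝ) (f : Rd d → ℝ) (lam : ℝ)
    (Qset : Set (ℤ × (Fin d → ℤ))) (b : ℤ × (Fin d → ℤ) → Rd d → ℝ) : Prop where
  pairwise_disjoint : Qset.Pairwise fun q q' =>
    Disjoint (dcube d 0 q.1 q.2) (dcube d 0 q'.1 q'.2)
  support_subset : ∀ q ∈ Qset, Function.support (b q) ⊆ dcube d 0 q.1 q.2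
  integrable : ∀ q ∈ Qset, Integrable (b q)
  integral_zero : ∀ q ∈ Qset, (∫ x, b q x) = 0
  l1_bound : ∀ q ∈ Qset, (∫ x, |b q x|) ≤ Cc * ∫ x in dcube d 0 q.1 q.2, |f x|
  avg_lower : ∀ q ∈ Qset, c₁ * lam / COm ≤
    (∫ x in dcube d 0 q.1 q.2, |f x|) / (volume (dcube d 0 q.1 q.2)).toReal
  avg_upper : ∀ q ∈ Qset,
    (∫ x in dcube d 0 q.1 q.2, |f x|) / (volume (dcube d 0 q.1 q.2)).toReal ≤ c₂ * lam / COm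

/-- `b_m = Σ_{Q ∈ 𝒬, l(Q) = 2^m} b_Q`. -/
def bsum (d : ℕ) (Qset : Set (ℤ × (Fin d → ℤ))) (b : ℤ × (Fin d → ℤ) → Rd d → ℝ)
    (m : ℤ) (x : Rd d) : ℝ :=
  ∑' mv : Fin d → ℤ, Set.indicator Qset (fun q => b q x) (m, mv)

/-- `φ` is smooth and supported in the annulus `{2^{-4} < |x| < 2^{-2}}`. -/
def PhiSupp (d : ℕ) (φ : Rd d → ℝ) : Prop :=
  ContDiff ℝ (⊤ : ℕ∞) φ ∧
  tsupport φ ⊆ {x : Rd d | (2:ℝ) ^ (-4 : ℤ) < ‖x‖ ∧ ‖x‖ < (2:ℝ) ^ (-2 : ℤ)}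

/-- The cutoff `Φ`: smooth, `0 ≤ Φ ≤ 1`, `Φ = 1` on `|t| ≤ 2` and `Φ = 0` on `|t| > 4`. -/
def CutoffHyp (Φ : ℝ → ℝ) : Prop :=
  ContDiff ℝ (⊤ : ℕ∞) Φ ∧ (∀ t, 0 ≤ Φ t ∧ Φ t ≤ 1) ∧
  (∀ t : ℝ, |t| ≤ 2 → Φ t = 1) ∧ (∀ t : ℝ, 4 < |t| → Φ t = 0)

/-- The microlocal kernel `𝒦_j^v(x) = 𝒦_j(x) χ_{E}(x/|x|)`. -/
def Kv (d : ℕ) (φ Om : Rd d → ℝ) (E : Set (Rd d)) (j : ℤ) (x : Rd d) : ℝ :=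
  Kker d φ Om j x * Set.indicator E (fun _ => (1:ℝ)) (‖x‖⁻¹ • x)

/-- The microlocal piece `T_j^v g = 𝒦_j^v * g`. -/
def Tjv (d : ℕ) (φ Om : Rd d → ℝ) (E : Set (Rd d)) (j : ℤ) (g : Rd d → ℝ) (x : Rd d) : ℝ :=
  ∫ y, Kv d φ Om E j (x - y) * g y

/-- The Fourier multiplier operator `G_v^s` with symbol `Φ(2^{sγ}⟨e_v, ξ/|ξ|⟩)`. -/
def Gop (d : ℕ) (Φ : ℝ → ℝ) (γ : ℝ) (s : ℕ) (e : Rd d) (g : Rd d → ℂ) (x : Rd d) : ℂ :=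
  𝓕⁻ (fun ξ : Rd d => (Φ ((2:ℝ) ^ (γ * s) * ⟪e, ‖ξ‖⁻¹ • ξ⟫) : ℂ) * 𝓕 g ξ) x

/-- The microlocal decomposition: a `2^{-sγ-4}`-separated family of unit vectors `e_v`
and disjoint measurable sets `E_v ⊆ S^{d-1}` of diameter at most `2^{-sγ-2}` with
`e_v ∈ E_v` covering the sphere. -/
def MicroFamily (d : ℕ) (γ : ℝ) (s : ℕ) {V : Type} (e : V → Rd d)
    (E : V → Set (Rd d)) : Prop :=
  (∀ v, ‖e v‖ = 1) ∧
  (∀ v v', v ≠ v' → (2:ℝ) ^ (-(s:ℝ) * γ - 4) ≤ ‖e v - e v'‖) ∧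
  (∀ v, MeasurableSet (E v)) ∧
  (∀ v, E v ⊆ Metric.sphere (0 : Rd d) 1) ∧
  (Pairwise fun v v' => Disjoint (E v) (E v')) ∧
  (∀ v, e v ∈ E v) ∧
  (∀ v, Metric.diam (E v) ≤ (2:ℝ) ^ (-(s:ℝ) * γ - 2)) ∧
  (⋃ v, E v) = Metric.sphere (0 : Rd d) 1

/-- A collection of dyadic cubes with pairwise disjoint interiors carrying bad functions
`b_Q` with `supp b_Q ⊆ Q` and `‖b_Q‖_{L¹} ≤ α|Q|`. -/
def BadFam (d : ℕ) (Qset : Set (ℤ × (Fin d → ℤ)))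
    (b : ℤ × (Fin d → ℤ) → Rd d → ℝ) (α : ℝ) : Prop :=
  (Qset.Pairwise fun q q' =>
    Disjoint (interior (dcube d 0 q.1 q.2)) (interior (dcube d 0 q'.1 q'.2))) ∧
  (∀ q ∈ Qset, Function.support (b q) ⊆ dcube d 0 q.1 q.2) ∧
  (∀ q ∈ Qset, Integrable (b q)) ∧
  (∀ q ∈ Qset, (∫ x, |b q x|) ≤ α * (volume (dcube d 0 q.1 q.2)).toReal)


lemma eLpNorm_pow_eq_lintegral {α F : Type*} [MeasurableSpace α] [NormedAddCommGroup F]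
    {μ : Measure α} (f : α → F) (n : ℕ) (hn : n ≠ 0) :
    eLpNorm f n μ ^ n = ∫⁻ x, ‖f x‖ₑ ^ n ∂μ := by
  have h := eLpNorm_nnreal_pow_eq_lintegral (μ := μ) (f := f) (p := (n : NNReal))
    (by exact_mod_cast hn)
  simpa using h

/-- Minkowski's integral inequality in `L⁴`, with a strictly positive majorant. -/
lemma eLpNorm_four_integral_le {T α : Type*} [MeasurableSpace T] [MeasurableSpace α]
    {μ : Measure T} {ν : Measure α} [SFinite μ] [SFinite ν] {G : T → α → ℂ}
    (hG : AEStronglyMeasurable (Function.uncurry G) (μ.prod ν)) {W : T → ℝ}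
    (hW : Measurable W) (hpos : ∀ t, 0 < W t) {N : ℝ≥0∞}
    (hN : ∀ᵐ t ∂μ, eLpNorm (G t) 4 ν ≤ ENNReal.ofReal (W t) * N) :
    eLpNorm (fun x => ∫ t, G t x ∂μ) 4 ν ≤ (∫⁻ t, ENNReal.ofReal (W t) ∂μ) * N := by
  have key (H : α → ℂ) : eLpNorm H 4 ν ^ 4 = ∫⁻ x, ‖H x‖ₑ ^ 4 ∂ν := by
    simpa using eLpNorm_pow_eq_lintegral (μ := ν) H 4 (by norm_num)
  set w : T → ℝ≥0∞ := fun t => ENNReal.ofReal (W t) with hw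
  have hwm : Measurable w := hW.ennreal_ofReal
  have hw0 : ∀ t, w t ≠ 0 := fun t => by simp [hw, hpos t]
  have hwt : ∀ t, w t ≠ ⊤ := fun t => by simp [hw]
  have hGe : AEMeasurable (fun z : T × α => ‖G z.1 z.2‖ₑ) (μ.prod ν) := hG.enorm
  have hGx : ∀ᵐ x ∂ν, AEMeasurable (fun t => ‖G t x‖ₑ) μ := by
    have := hG.prod_swap.prodMk_left
    filter_upwards [this] with x hx using hx.enorm
  have hpt : ∀ᵐ x ∂ν, ‖∫ t, G t x ∂μ‖ₑ ^ 4 ≤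
      (∫⁻ t, w t ∂μ) ^ 3 * ∫⁻ t, ‖G t x‖ₑ ^ 4 * ((w t)⁻¹) ^ 3 ∂μ := by
    filter_upwards [hGx] with x hx
    have h1 : ‖∫ t, G t x ∂μ‖ₑ ≤ ∫⁻ t, ‖G t x‖ₑ ∂μ := enorm_integral_le_lintegral_enorm _
    have h2 := ENNReal.lintegral_mul_le_Lp_mul_Lq μ (p := 4) (q := 4 / 3)
      (by rw [Real.holderConjugate_iff]; norm_num)
      (f := fun t => ‖G t x‖ₑ * ((w t)⁻¹) ^ (3 / 4 : ℝ)) (g := fun t => w t ^ (3 / 4 : ℝ))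
      (hx.mul (hwm.inv.pow_const _).aemeasurable) (hwm.pow_const _).aemeasurable
    have e1 : ∀ t, ((fun t => ‖G t x‖ₑ * ((w t)⁻¹) ^ (3 / 4 : ℝ)) *
        fun t => w t ^ (3 / 4 : ℝ)) t = ‖G t x‖ₑ := fun t => by
      simp only [Pi.mul_apply]
      rw [mul_assoc, ← ENNReal.mul_rpow_of_nonneg _ _ (by norm_num),
        ENNReal.inv_mul_cancel (hw0 t) (hwt t)]
      simp
    have e2 : ∀ t, (‖G t x‖ₑ * ((w t)⁻¹) ^ (3 / 4 : ℝ)) ^ (4 : ℝ) =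
        ‖G t x‖ₑ ^ 4 * ((w t)⁻¹) ^ 3 := fun t => by
      rw [ENNReal.mul_rpow_of_nonneg _ _ (by norm_num), ← ENNReal.rpow_mul,
        ← ENNReal.rpow_natCast, ← ENNReal.rpow_natCast]
      norm_num
    have e3 : ∀ t, (w t ^ (3 / 4 : ℝ)) ^ (4 / 3 : ℝ) = w t := fun t => by
      rw [← ENNReal.rpow_mul]; norm_num
    simp only [e1, e2, e3] at h2
    calc ‖∫ t, G t x ∂μ‖ₑ ^ 4 ≤ (∫⁻ t, ‖G t x‖ₑ ∂μ) ^ 4 := by gcongr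
      _ ≤ ((∫⁻ t, ‖G t x‖ₑ ^ 4 * ((w t)⁻¹) ^ 3 ∂μ) ^ (1 / 4 : ℝ) *
            (∫⁻ t, w t ∂μ) ^ (1 / (4 / 3) : ℝ)) ^ 4 := by gcongr
      _ = _ := by
        rw [← ENNReal.rpow_natCast, ENNReal.mul_rpow_of_nonneg _ _ (by norm_num),
          ← ENNReal.rpow_mul, ← ENNReal.rpow_mul, mul_comm]
        norm_num
  have hmeas : AEMeasurable (fun z : T × α => ‖G z.1 z.2‖ₑ ^ 4 * ((w z.1)⁻¹) ^ 3) (μ.prod ν) :=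
    (hGe.pow_const 4).mul ((hwm.inv.pow_const 3).comp measurable_fst).aemeasurable
  have hlt : ∫⁻ x, ‖∫ t, G t x ∂μ‖ₑ ^ 4 ∂ν ≤ ((∫⁻ t, w t ∂μ) * N) ^ 4 := by
    calc ∫⁻ x, ‖∫ t, G t x ∂μ‖ₑ ^ 4 ∂ν
        ≤ ∫⁻ x, (∫⁻ t, w t ∂μ) ^ 3 * ∫⁻ t, ‖G t x‖ₑ ^ 4 * ((w t)⁻¹) ^ 3 ∂μ ∂ν :=
          lintegral_mono_ae hpt
      _ = (∫⁻ t, w t ∂μ) ^ 3 * ∫⁻ x, ∫⁻ t, ‖G t x‖ₑ ^ 4 * ((w t)⁻¹) ^ 3 ∂μ ∂ν :=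
          lintegral_const_mul'' _ hmeas.lintegral_prod_left'
      _ = (∫⁻ t, w t ∂μ) ^ 3 * ∫⁻ t, ∫⁻ x, ‖G t x‖ₑ ^ 4 * ((w t)⁻¹) ^ 3 ∂ν ∂μ := by
          rw [lintegral_lintegral_swap]
          exact hmeas.prod_swap
      _ ≤ (∫⁻ t, w t ∂μ) ^ 3 * ∫⁻ t, w t * N ^ 4 ∂μ := by
          gcongr 1
          apply lintegral_mono_ae
          filter_upwards [hN] with t ht
          have h3 : ((w t)⁻¹) ^ 3 ≠ ⊤ := by simp [hw0 t]
          calc ∫⁻ x, ‖G t x‖ₑ ^ 4 * ((w t)⁻¹) ^ 3 ∂ν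
              = (∫⁻ x, ‖G t x‖ₑ ^ 4 ∂ν) * ((w t)⁻¹) ^ 3 := lintegral_mul_const' _ _ h3
            _ ≤ (w t * N) ^ 4 * ((w t)⁻¹) ^ 3 := by
              rw [← key]; gcongr
            _ = (w t * (w t)⁻¹) ^ 3 * (w t * N ^ 4) := by ring
            _ = w t * N ^ 4 := by rw [ENNReal.mul_inv_cancel (hw0 t) (hwt t)]; simp
      _ = ((∫⁻ t, w t ∂μ) * N) ^ 4 := by
          rw [lintegral_mul_const _ hwm]; ring
  rw [← key] at hlt
  exact (ENNReal.pow_le_pow_left_iff (n := 4) (by norm_num)).1 hlt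

lemma memLp_two_fourier {d : ℕ} {h : Rd d → ℂ} (h1 : Integrable h) (h2 : MemLp h 2) :
    MemLp (𝓕 h) 2 ∧ eLpNorm (𝓕 h) 2 = eLpNorm h 2 := by
  set g : Lp ℂ 2 (volume : Measure (Rd d)) := h2.toLp h with hg
  have hcont : Continuous (𝓕 h) :=
    VectorFourier.fourierIntegral_continuous Real.continuous_fourierChar continuous_inner h1
  obtain ⟨k, hk⟩ : ∃ k : Lp ℂ 2 (volume : Measure (Rd d)), k = 𝓕 g := ⟨_, rfl⟩
  have hkl : LocallyIntegrable (k : Rd d → ℂ) := by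
    exact MemLp.locallyIntegrable (Lp.memLp k) (by norm_num)
  have hfl : LocallyIntegrable (𝓕 h) (volume : Measure (Rd d)) := hcont.locallyIntegrable
  have hae : (k : Rd d → ℂ) =ᵐ[volume] 𝓕 h := by
    refine ae_eq_of_integral_contDiff_smul_eq hkl hfl fun ψ hψ hψc => ?_
    have hcs : HasCompactSupport (fun x => (ψ x : ℂ)) := 
      hψc.comp_left (g := Complex.ofReal) Complex.ofReal_zero
    have hcd : ContDiff ℝ (⊤ : ℕ∞) (fun x => (ψ x : ℂ)) :=
      Complex.ofRealCLM.contDiff.comp hψ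
    set Ψ : SchwartzMap (Rd d) ℂ := hcs.toSchwartzMap hcd with hΨ
    have hΨx : ∀ x, Ψ x = (ψ x : ℂ) := fun x => rfl
    have e := congrArg (fun D => D Ψ) (Lp.fourier_toTemperedDistribution_eq g)
    rw [← hk] at e
    simp only [TemperedDistribution.fourier_apply, Lp.toTemperedDistribution_apply] at e
    have e' : ∫ x, (𝓕 Ψ : SchwartzMap (Rd d) ℂ) x • g x = ∫ x, 𝓕 (fun y => Ψ y) x • h x := by
      apply integral_congr_ae
      filter_upwards [h2.coeFn_toLp] with x hx
      rw [hg, hx]; rfl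
    rw [e'] at e
    have f := VectorFourier.integral_fourierIntegral_smul_eq_flip (L := innerₗ (Rd d))
      (μ := volume) (ν := volume) Real.continuous_fourierChar continuous_inner
      (f := fun y => Ψ y) (g := h) Ψ.integrable h1
    rw [flip_innerₗ] at f
    have f' : ∫ x, 𝓕 (fun y => Ψ y) x • h x = ∫ x, Ψ x • 𝓕 h x := f
    rw [f'] at e
    simpa only [hΨx, Complex.coe_smul] using e.symm
  refine ⟨(memLp_congr_ae hae).1 (Lp.memLp _), ?_⟩
  rw [← eLpNorm_congr_ae hae, ← eLpNorm_congr_ae h2.coeFn_toLp]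
  have := Lp.norm_fourier_eq g
  rw [← hk] at this
  rw [Lp.norm_def, Lp.norm_def] at this
  exact (ENNReal.toReal_eq_toReal_iff' (Lp.eLpNorm_ne_top _) (Lp.eLpNorm_ne_top _)).1 this

lemma memLp_two_fourierInv {d : ℕ} {h : Rd d → ℂ} (h1 : Integrable h) (h2 : MemLp h 2) :
    MemLp (𝓕⁻ h) 2 ∧ eLpNorm (𝓕⁻ h) 2 = eLpNorm h 2 := by
  have hmp := Measure.measurePreserving_neg (volume : Measure (Rd d))
  rw [Real.fourierInv_eq_fourier_comp_neg]
  have := memLp_two_fourier (h := fun x => h (-x)) h1.comp_neg (h2.comp_measurePreserving hmp)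
  exact ⟨this.1, this.2.trans (eLpNorm_comp_measurePreserving h2.1 hmp)⟩

lemma continuous_fourierInv {d : ℕ} {h : Rd d → ℂ} (h1 : Integrable h) : Continuous (𝓕⁻ h) := by
  rw [Real.fourierInv_eq_fourier_comp_neg]
  exact VectorFourier.fourierIntegral_continuous Real.continuous_fourierChar continuous_inner
    h1.comp_neg

/-- `m` is a bounded Fourier multiplier on `L⁴`, with norm at most `A`, tested on the inverse
Fourier transforms of functions in `L¹ ∩ L²`. -/
structure IsMultiplierFour {d : ℕ} (A : ℝ) (m : Rd d → ℂ) : Prop where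
  measurable : Measurable m
  bounded : ∃ K : ℝ, ∀ ξ, ‖m ξ‖ ≤ K
  nonneg : 0 ≤ A
  bound : ∀ h : Rd d → ℂ, Integrable h → MemLp h 2 →
    eLpNorm (𝓕⁻ fun ξ => m ξ * h ξ) 4 ≤ ENNReal.ofReal A * eLpNorm (𝓕⁻ h) 4

lemma integrable_bdd_mul {d : ℕ} {m h : Rd d → ℂ} (hm : AEStronglyMeasurable m)
    (hb : ∃ K : ℝ, ∀ ξ, ‖m ξ‖ ≤ K) (h1 : Integrable h) : Integrable fun ξ => m ξ * h ξ := by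
  obtain ⟨K, hK⟩ := hb
  exact h1.bdd_mul hm (Filter.Eventually.of_forall hK)

lemma memLp_bdd_mul {d : ℕ} {m h : Rd d → ℂ} {p : ℝ≥0∞} (hm : AEStronglyMeasurable m)
    (hb : ∃ K : ℝ, ∀ ξ, ‖m ξ‖ ≤ K) (h1 : MemLp h p) : MemLp (fun ξ => m ξ * h ξ) p := by
  obtain ⟨K, hK⟩ := hb
  refine h1.of_le_mul (c := K) (hm.mul h1.1) (Filter.Eventually.of_forall fun ξ => ?_)
  rw [norm_mul]
  exact mul_le_mul_of_nonneg_right (hK ξ) (norm_nonneg _)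

lemma fourierInv_add_fun {d : ℕ} {f g : Rd d → ℂ} (hf : Integrable f) (hg : Integrable g) :
    𝓕⁻ (fun ξ => f ξ + g ξ) = fun x => 𝓕⁻ f x + 𝓕⁻ g x := by
  ext x
  simp only [Real.fourierInv_eq, smul_add]
  refine integral_add ?_ ?_
  · simpa using (Real.fourierIntegral_convergent_iff (-x)).2 hf
  · simpa using (Real.fourierIntegral_convergent_iff (-x)).2 hg

lemma fourierInv_const_mul_fun {d : ℕ} (c : ℂ) (f : Rd d → ℂ) :
    𝓕⁻ (fun ξ => c * f ξ) = fun x => c * 𝓕⁻ f x := by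
  ext x
  simp only [Real.fourierInv_eq, ← integral_const_mul]
  congr 1 with ξ
  simp only [Circle.smul_def, smul_eq_mul]
  ring

lemma fourierInv_congr_ae {d : ℕ} {f g : Rd d → ℂ} (h : f =ᵐ[volume] g) : 𝓕⁻ f = 𝓕⁻ g := by
  ext x
  simp only [Real.fourierInv_eq]
  apply integral_congr_ae
  filter_upwards [h] with ξ hξ
  rw [hξ]

namespace IsMultiplierFour

variable {d : ℕ} {A B : ℝ} {m m' : Rd d → ℂ}

lemma integrable_mul (hm : IsMultiplierFour A m) {h : Rd d → ℂ} (h1 : Integrable h) :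
    Integrable fun ξ => m ξ * h ξ :=
  integrable_bdd_mul hm.measurable.aestronglyMeasurable hm.bounded h1

lemma memLp_mul (hm : IsMultiplierFour A m) {h : Rd d → ℂ} {p : ℝ≥0∞} (h1 : MemLp h p) :
    MemLp (fun ξ => m ξ * h ξ) p :=
  memLp_bdd_mul hm.measurable.aestronglyMeasurable hm.bounded h1

lemma mono (hm : IsMultiplierFour A m) (hAB : A ≤ B) : IsMultiplierFour B m :=
  ⟨hm.measurable, hm.bounded, hm.nonneg.trans hAB, fun h h1 h2 =>
    (hm.bound h h1 h2).trans (by gcongr)⟩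

lemma const (c : ℂ) : IsMultiplierFour (d := d) ‖c‖ fun _ => c := by
  refine ⟨measurable_const, ⟨‖c‖, fun _ => le_rfl⟩, norm_nonneg _, fun h _ _ => ?_⟩
  rw [fourierInv_const_mul_fun, ofReal_norm]
  exact (eLpNorm_const_smul c (𝓕⁻ h) 4 volume).le

lemma mul (hm : IsMultiplierFour A m) (hm' : IsMultiplierFour B m') :
    IsMultiplierFour (A * B) fun ξ => m ξ * m' ξ := by
  refine ⟨hm.measurable.mul hm'.measurable, ?_, mul_nonneg hm.nonneg hm'.nonneg,
    fun h h1 h2 => ?_⟩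
  · obtain ⟨K, hK⟩ := hm.bounded
    obtain ⟨K', hK'⟩ := hm'.bounded
    refine ⟨K * K', fun ξ => ?_⟩
    rw [norm_mul]
    exact mul_le_mul (hK ξ) (hK' ξ) (norm_nonneg _) ((norm_nonneg _).trans (hK ξ))
  · simp only [mul_assoc]
    refine (hm.bound _ (hm'.integrable_mul h1) (hm'.memLp_mul h2)).trans ?_
    rw [ENNReal.ofReal_mul hm.nonneg, mul_assoc]
    gcongr
    exact hm'.bound h h1 h2

lemma add (hm : IsMultiplierFour A m) (hm' : IsMultiplierFour B m') :
    IsMultiplierFour (A + B) fun ξ => m ξ + m' ξ := by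
  refine ⟨hm.measurable.add hm'.measurable, ?_, add_nonneg hm.nonneg hm'.nonneg,
    fun h h1 h2 => ?_⟩
  · obtain ⟨K, hK⟩ := hm.bounded
    obtain ⟨K', hK'⟩ := hm'.bounded
    exact ⟨K + K', fun ξ => (norm_add_le _ _).trans (add_le_add (hK ξ) (hK' ξ))⟩
  · simp only [add_mul]
    rw [fourierInv_add_fun (hm.integrable_mul h1) (hm'.integrable_mul h1)]
    refine (eLpNorm_add_le (continuous_fourierInv (hm.integrable_mul h1)).aestronglyMeasurable
      (continuous_fourierInv (hm'.integrable_mul h1)).aestronglyMeasurable (by norm_num)).trans ?_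
    rw [ENNReal.ofReal_add hm.nonneg hm'.nonneg, add_mul]
    gcongr
    · exact hm.bound h h1 h2
    · exact hm'.bound h h1 h2

lemma const_mul (hm : IsMultiplierFour A m) (c : ℂ) :
    IsMultiplierFour (‖c‖ * A) fun ξ => c * m ξ :=
  (const c).mul hm

lemma sub (hm : IsMultiplierFour A m) (hm' : IsMultiplierFour B m') :
    IsMultiplierFour (A + B) fun ξ => m ξ - m' ξ := by
  simpa [sub_eq_add_neg] using hm.add (hm'.const_mul (-1))

lemma congr_ae (hm : IsMultiplierFour A m) (hmeas : Measurable m')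
    (hb : ∃ K : ℝ, ∀ ξ, ‖m' ξ‖ ≤ K) (h : m =ᵐ[volume] m') : IsMultiplierFour A m' := by
  refine ⟨hmeas, hb, hm.nonneg, fun k h1 h2 => ?_⟩
  rw [fourierInv_congr_ae (f := fun ξ => m' ξ * k ξ) (g := fun ξ => m ξ * k ξ)]
  · exact hm.bound k h1 h2
  · filter_upwards [h] with ξ hξ
    rw [hξ]

lemma finset_prod {ι : Type*} (s : Finset ι) {a : ι → ℝ} {M : ι → Rd d → ℂ}
    (hM : ∀ i ∈ s, IsMultiplierFour (a i) (M i)) :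
    IsMultiplierFour (∏ i ∈ s, a i) fun ξ => ∏ i ∈ s, M i ξ := by
  classical
  induction s using Finset.induction_on with
  | empty => simpa using const (d := d) 1
  | insert i s hi ih =>
    simp only [Finset.prod_insert hi]
    exact (hM i (Finset.mem_insert_self _ _)).mul
      (ih fun j hj => hM j (Finset.mem_insert_of_mem hj))

/-- A weighted superposition of multipliers is a multiplier. -/
lemma integral {T : Type*} [MeasurableSpace T] {μ : Measure T} [SFinite μ] {M : T → Rd d → ℂ}
    (hM : Measurable (Function.uncurry M)) {W K : T → ℝ} (hW : Measurable W)
    (hpos : ∀ t, 0 < W t) (hint : Integrable W μ) (hK : Integrable K μ)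
    (hbdd : ∀ t ξ, ‖M t ξ‖ ≤ K t)
    (hmul : ∀ᵐ t ∂μ, IsMultiplierFour (W t) (M t)) :
    IsMultiplierFour (∫ t, W t ∂μ) fun ξ => ∫ t, M t ξ ∂μ := by
  have hMs : StronglyMeasurable (Function.uncurry M) := hM.stronglyMeasurable
  refine ⟨hMs.integral_prod_left.measurable, ⟨∫ t, K t ∂μ, fun ξ => ?_⟩,
    integral_nonneg fun t => (hpos t).le, fun h h1 h2 => ?_⟩
  · exact norm_integral_le_of_norm_le hK (Filter.Eventually.of_forall fun t => hbdd t ξ)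
  obtain ⟨h', hh', hae⟩ := h1.1
  have h1' : Integrable h' := h1.congr hae
  have key : 𝓕⁻ (fun ξ => (∫ t, M t ξ ∂μ) * h ξ) =
      fun x => ∫ t, 𝓕⁻ (fun ξ => M t ξ * h' ξ) x ∂μ := by
    rw [fourierInv_congr_ae (g := fun ξ => (∫ t, M t ξ ∂μ) * h' ξ)
      (by filter_upwards [hae] with ξ hξ; rw [hξ])]
    ext x
    simp only [Real.fourierInv_eq]
    rw [integral_integral_swap]
    · congr 1 with ξ
      simp only [Circle.smul_def, smul_eq_mul]
      rw [integral_const_mul, integral_mul_const]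
    · have hc : Continuous fun ξ : Rd d => (Real.fourierChar (inner ℝ ξ x) : ℂ) := by fun_prop
      refine ((hK.mul_prod h1'.norm)).mono' ?_ ?_
      · refine Measurable.aestronglyMeasurable ?_
        simp only [Function.uncurry_def, Circle.smul_def, smul_eq_mul]
        exact (hc.measurable.comp measurable_snd).mul
          (hM.mul (hh'.measurable.comp measurable_snd))
      · refine Filter.Eventually.of_forall fun z => ?_
        simp only [Function.uncurry_def, Circle.smul_def, smul_eq_mul, norm_mul,
          Circle.norm_coe, one_mul]
        exact mul_le_mul_of_nonneg_right (hbdd _ _) (norm_nonneg _)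
  rw [key, ofReal_integral_eq_lintegral_ofReal hint
    (Filter.Eventually.of_forall fun t => (hpos t).le)]
  refine eLpNorm_four_integral_le ?_ hW hpos ?_
  · refine StronglyMeasurable.aestronglyMeasurable ?_
    simp only [Function.uncurry_def, Real.fourierInv_eq]
    refine StronglyMeasurable.integral_prod_right
      (f := fun (z : T × Rd d) ξ => Real.fourierChar (inner ℝ ξ z.2) • (M z.1 ξ * h' ξ)) ?_
    refine Measurable.stronglyMeasurable ?_
    simp only [Function.uncurry_def, Circle.smul_def, smul_eq_mul]
    have hc2 : Continuous fun z : Rd d × Rd d => (Real.fourierChar (inner ℝ z.2 z.1) : ℂ) := by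
      fun_prop
    have e1 : Measurable fun z : (T × Rd d) × Rd d => (z.1.2, z.2) := by fun_prop
    have e2 : Measurable fun z : (T × Rd d) × Rd d => (z.1.1, z.2) := by fun_prop
    exact (hc2.measurable.comp e1).mul ((hM.comp e2).mul (hh'.measurable.comp measurable_snd))
  · filter_upwards [hmul] with t ht
    have := ht.bound h h1 h2
    rwa [fourierInv_congr_ae (f := fun ξ => M t ξ * h ξ) (g := fun ξ => M t ξ * h' ξ)
      (by filter_upwards [hae] with ξ hξ; rw [hξ])] at this

end IsMultiplierFour

lemma integral_fourier_mul {d : ℕ} {f g : Rd d → ℂ} (hf : Integrable f) (hg : Integrable g) :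
    ∫ ξ, 𝓕 f ξ * g ξ = ∫ x, f x * 𝓕 g x := by
  have h := VectorFourier.integral_fourierIntegral_smul_eq_flip (L := innerₗ (Rd d))
    (μ := volume) (ν := volume) Real.continuous_fourierChar continuous_inner hf hg
  rw [flip_innerₗ] at h
  exact h

/-- If `h` lives in an open half-space through the origin and has integrable Fourier transform,
then the integral of the Fourier transform vanishes. -/
lemma integral_fourier_eq_zero_of_halfspace {d : ℕ} {θ : Rd d} (hθ : θ ≠ 0) {h : Rd d → ℂ}
    (h1 : Integrable h) (hsupp : ∀ ξ, ⟪ξ, θ⟫ ≤ 0 → h ξ = 0) (hF : Integrable (𝓕 h)) :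
    ∫ x, 𝓕 h x = 0 := by
  set b : ℝ → ℝ := fun y => Real.pi / y ^ 2 with hb
  set p : ℝ → Rd d := fun y => (-(√y)⁻¹) • θ with hp
  set g : ℝ → Rd d → ℂ := fun y v =>
    Complex.exp (-(b y : ℂ) * ‖v‖ ^ 2 + 2 * Real.pi * Complex.I * (inner ℝ (p y) v : ℝ)) with hg
  have hbpos : ∀ y, 0 < y → 0 < b y := fun y hy => by positivity
  have hgi : ∀ y, 0 < y → Integrable (g y) := fun y hy =>
    GaussianFourier.integrable_cexp_neg_mul_sq_norm_add (b := (b y : ℂ))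
      (by simpa using hbpos y hy) _ _
  have hgn : ∀ y v, ‖g y v‖ = Real.exp (-(b y) * ‖v‖ ^ 2) := fun y v => by
    have e : (-(b y : ℂ) * ‖v‖ ^ 2 + 2 * Real.pi * Complex.I * (inner ℝ (p y) v : ℝ)) =
      ((-(b y) * ‖v‖ ^ 2 : ℝ) : ℂ) + ((2 * Real.pi * inner ℝ (p y) v : ℝ) : ℂ) * Complex.I := by
      push_cast; ring
    simp only [hg]
    rw [e, Complex.norm_exp]
    simp [-Complex.ofReal_mul, -Complex.ofReal_neg, -Complex.ofReal_pow]
  have hlim1 : Filter.Tendsto (fun y => ∫ x, 𝓕 h x * g y x) Filter.atTop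
      (nhds (∫ x, 𝓕 h x * 1)) := by
    refine tendsto_integral_filter_of_dominated_convergence (fun x => ‖𝓕 h x‖) ?_ ?_ hF.norm ?_
    · filter_upwards [Filter.eventually_gt_atTop 0] with y hy
      exact hF.1.mul (hgi y hy).1
    · filter_upwards [Filter.eventually_gt_atTop 0] with y hy
      refine Filter.Eventually.of_forall fun x => ?_
      rw [norm_mul, hgn]
      refine mul_le_of_le_one_right (norm_nonneg _) (Real.exp_le_one_iff.2 ?_)
      have := hbpos y hy
      have : 0 ≤ b y * ‖x‖ ^ 2 := by positivity
      linarith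
    · refine Filter.Eventually.of_forall fun x => ?_
      refine Filter.Tendsto.const_mul _ ?_
      have hb0 : Filter.Tendsto b Filter.atTop (nhds 0) :=
        Filter.Tendsto.const_div_atTop (Filter.tendsto_pow_atTop two_ne_zero) _
      have hi : Filter.Tendsto (fun y : ℝ => -(√y)⁻¹) Filter.atTop (nhds 0) := by
        simpa using (Real.tendsto_sqrt_atTop.inv_tendsto_atTop).neg
      have hin : Filter.Tendsto (fun y => inner ℝ (p y) x) Filter.atTop (nhds 0) := by
        have : ∀ y, inner ℝ (p y) x = -(√y)⁻¹ * inner ℝ θ x := fun y => by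
          simp only [hp, real_inner_smul_left]
        simp only [this]
        simpa using hi.mul_const (inner ℝ θ x)
      have : Filter.Tendsto (fun y => -(b y : ℂ) * ‖x‖ ^ 2 +
          2 * Real.pi * Complex.I * (inner ℝ (p y) x : ℝ)) Filter.atTop (nhds 0) := by
        have hb' : Filter.Tendsto (fun y => (b y : ℂ)) Filter.atTop (nhds ((0 : ℝ) : ℂ)) :=
          (Complex.continuous_ofReal.tendsto _).comp hb0
        have hin' : Filter.Tendsto (fun y => ((inner ℝ (p y) x : ℝ) : ℂ)) Filter.atTop
          (nhds ((0 : ℝ) : ℂ)) := (Complex.continuous_ofReal.tendsto _).comp hin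
        simpa using (hb'.neg.mul_const ((‖x‖ : ℂ) ^ 2)).add
          (hin'.const_mul (2 * Real.pi * Complex.I))
      simpa [hg, Function.comp_def] using (Complex.continuous_exp.tendsto _).comp this
  have hlim2 : Filter.Tendsto (fun y => ∫ x, 𝓕 h x * g y x) Filter.atTop (nhds 0) := by
    have hbound : ∀ y : ℝ, 0 < y → ‖∫ x, 𝓕 h x * g y x‖ ≤
        (∫ x, ‖h x‖) * (y ^ (d : ℝ) * Real.exp (-(Real.pi * ‖θ‖ ^ 2) * y)) := by
      intro y hy
      rw [integral_fourier_mul h1 (hgi y hy), ← integral_mul_const]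
      refine norm_integral_le_of_norm_le (h1.norm.mul_const _) (Filter.Eventually.of_forall
        fun w => ?_)
      rw [norm_mul]
      by_cases hw : ⟪w, θ⟫ ≤ 0
      · simp [hsupp w hw]
      push Not at hw
      refine mul_le_mul_of_nonneg_left ?_ (norm_nonneg _)
      simp only [hg]
      rw [fourier_gaussian_innerProductSpace' (b := (b y : ℂ)) (by simpa using hbpos y hy)]
      rw [norm_mul]
      have e1 : (Real.pi : ℂ) / (b y : ℂ) = ((y ^ 2 : ℝ) : ℂ) := by
        rw [← Complex.ofReal_div]
        congr 1
        simp only [hb]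
        field_simp
      have e2 : -(Real.pi : ℂ) ^ 2 * ‖p y - w‖ ^ 2 / (b y : ℂ) =
          ((-(Real.pi ^ 2 * ‖p y - w‖ ^ 2 / b y) : ℝ) : ℂ) := by push_cast; ring
      rw [e1, Complex.norm_cpow_eq_rpow_re_of_pos (by positivity), e2, ← Complex.ofReal_exp,
        Complex.norm_real, Real.norm_of_nonneg (Real.exp_pos _).le]
      have e3 : ((Module.finrank ℝ (Rd d) : ℂ) / 2).re = (d : ℝ) / 2 := by
        rw [finrank_euclideanSpace_fin]
        simp
      rw [e3, ← Real.rpow_natCast, ← Real.rpow_mul hy.le]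
      have e4 : ((2 : ℕ) : ℝ) * ((d : ℝ) / 2) = d := by push_cast; ring
      rw [e4]
      refine mul_le_mul_of_nonneg_left (Real.exp_le_exp.2 ?_) (by positivity)
      have e5 : ‖θ‖ ^ 2 / y ≤ ‖p y - w‖ ^ 2 := by
        rw [norm_sub_sq_real]
        have e6 : ‖p y‖ ^ 2 = ‖θ‖ ^ 2 / y := by
          simp only [hp, norm_smul, norm_neg, norm_inv, mul_pow, inv_pow, Real.norm_eq_abs,
            sq_abs, Real.sq_sqrt hy.le]
          field_simp
        have e7 : inner ℝ (p y) w ≤ 0 := by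
          simp only [hp, real_inner_smul_left]
          have : 0 ≤ (√y)⁻¹ := by positivity
          rw [real_inner_comm]
          nlinarith
        rw [e6]
        nlinarith [sq_nonneg ‖w‖]
      have e8 : Real.pi ^ 2 * ‖p y - w‖ ^ 2 / b y = Real.pi * y ^ 2 * ‖p y - w‖ ^ 2 := by
        simp only [hb]; field_simp
      rw [e8]
      have : Real.pi * y ^ 2 * (‖θ‖ ^ 2 / y) ≤ Real.pi * y ^ 2 * ‖p y - w‖ ^ 2 := by gcongr
      have e9 : Real.pi * y ^ 2 * (‖θ‖ ^ 2 / y) = Real.pi * ‖θ‖ ^ 2 * y := by field_simp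
      linarith
    have h0 := (tendsto_rpow_mul_exp_neg_mul_atTop_nhds_zero d (Real.pi * ‖θ‖ ^ 2)
      (by positivity)).const_mul (∫ x, ‖h x‖)
    rw [mul_zero] at h0
    refine squeeze_zero_norm' ?_ h0
    filter_upwards [Filter.eventually_gt_atTop 0] with y hy using hbound y hy
  simpa using tendsto_nhds_unique hlim1 hlim2

/-- The fourth power of the Fourier transform of a function in a half-space integrates to zero. -/
lemma integral_fourier_pow_four_eq_zero {d : ℕ} {θ : Rd d} (hθ : θ ≠ 0) {h : Rd d → ℂ}
    (h1 : Integrable h) (hsupp : ∀ ξ, ⟪ξ, θ⟫ ≤ 0 → h ξ = 0)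
    (hF : Integrable fun x => 𝓕 h x ^ 4) : ∫ x, 𝓕 h x ^ 4 = 0 := by
  have conv (f g : Rd d → ℂ) (hf : Integrable f) (hg : Integrable g)
      (hfs : ∀ ξ, ⟪ξ, θ⟫ ≤ 0 → f ξ = 0) (hgs : ∀ ξ, ⟪ξ, θ⟫ ≤ 0 → g ξ = 0) :
      ∃ k : Rd d → ℂ, Integrable k ∧ (∀ ξ, ⟪ξ, θ⟫ ≤ 0 → k ξ = 0) ∧
        ∀ x, 𝓕 k x = 𝓕 f x * 𝓕 g x := by
    refine ⟨_, hf.integrable_convolution (ContinuousLinearMap.mul ℂ ℂ) hg, fun ξ hξ => ?_,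
      Real.fourier_mul_convolution_eq hf hg⟩
    rw [convolution_def]
    refine integral_eq_zero_of_ae (Filter.Eventually.of_forall fun t => ?_)
    simp only [ContinuousLinearMap.mul_apply', Pi.zero_apply, mul_eq_zero]
    by_cases ht : ⟪t, θ⟫ ≤ 0
    · exact Or.inl (hfs t ht)
    · refine Or.inr (hgs _ ?_)
      rw [inner_sub_left]
      linarith
  obtain ⟨k, hk1, hks, hk⟩ := conv h h h1 h1 hsupp hsupp
  obtain ⟨l, hl1, hls, hl⟩ := conv k k hk1 hk1 hks hks
  have e : (fun x => 𝓕 h x ^ 4) = 𝓕 l := by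
    ext x
    rw [hl, hk]
    ring
  rw [e] at hF
  have := integral_fourier_eq_zero_of_halfspace hθ hl1 hls hF
  rwa [← e] at this

lemma norm_pow_four_le (z : ℂ) : ‖z‖ ^ 4 ≤ 48 * z.re ^ 4 + 2 * (z ^ 4).re := by
  have h : ‖z‖ ^ 2 = z.re ^ 2 + z.im ^ 2 := by
    rw [← Complex.normSq_eq_norm_sq, Complex.normSq_apply]; ring
  have h4 : ‖z‖ ^ 4 = (z.re ^ 2 + z.im ^ 2) ^ 2 := by rw [← h]; ring
  have hr : (z ^ 4).re = z.re ^ 4 - 6 * z.re ^ 2 * z.im ^ 2 + z.im ^ 4 := by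
    simp only [pow_succ, pow_zero, one_mul, Complex.mul_re, Complex.mul_im]
    ring
  rw [h4, hr]
  nlinarith [sq_nonneg (7 * z.re ^ 2 - z.im ^ 2)]

/-- The real part of the Fourier transform of a function in a half-space controls the `L⁴` norm. -/
lemma lintegral_fourier_pow_four_le {d : ℕ} {θ : Rd d} (hθ : θ ≠ 0) {h : Rd d → ℂ}
    (h1 : Integrable h) (h2 : MemLp h 2) (hsupp : ∀ ξ, ⟪ξ, θ⟫ ≤ 0 → h ξ = 0) :
    ∫⁻ x, ‖𝓕 h x‖ₑ ^ 4 ≤ 48 * ∫⁻ x, ‖(𝓕 h x).re‖ₑ ^ 4 := by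
  have hcont : Continuous (𝓕 h) :=
    VectorFourier.fourierIntegral_continuous Real.continuous_fourierChar continuous_inner h1
  have hsq : Integrable fun x => ‖𝓕 h x‖ ^ 2 := by
    simpa using (memLp_two_iff_integrable_sq_norm hcont.aestronglyMeasurable).1
      (memLp_two_fourier h1 h2).1
  set K := ∫ ξ, ‖h ξ‖ with hK
  have hle : ∀ x, ‖𝓕 h x‖ ≤ K := fun x =>
    VectorFourier.norm_fourierIntegral_le_integral_norm _ _ _ _ _
  have hint : Integrable fun x => ‖𝓕 h x‖ ^ 4 := by
    refine (hsq.const_mul (K ^ 2)).mono' (by fun_prop) (Filter.Eventually.of_forall fun x => ?_)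
    rw [Real.norm_of_nonneg (by positivity)]
    have := pow_le_pow_left₀ (norm_nonneg _) (hle x) 2
    nlinarith [sq_nonneg ‖𝓕 h x‖]
  have hint4 : Integrable fun x => 𝓕 h x ^ 4 :=
    hint.mono' (by fun_prop) (Filter.Eventually.of_forall fun x => by simp)
  have hre : Integrable fun x => (𝓕 h x).re ^ 4 := by
    refine hint.mono' ?_ (Filter.Eventually.of_forall fun x => ?_)
    · exact (Complex.continuous_re.comp hcont).pow 4 |>.aestronglyMeasurable
    · rw [norm_pow, Real.norm_eq_abs]
      exact pow_le_pow_left₀ (abs_nonneg _) (Complex.abs_re_le_norm _) 4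
  have h0 := integral_fourier_pow_four_eq_zero hθ h1 hsupp hint4
  have h0' : ∫ x, (𝓕 h x ^ 4).re = 0 := by
    have := integral_re hint4
    simpa [h0] using this
  have hmain : ∫ x, ‖𝓕 h x‖ ^ 4 ≤ 48 * ∫ x, (𝓕 h x).re ^ 4 := by
    calc ∫ x, ‖𝓕 h x‖ ^ 4 ≤ ∫ x, (48 * (𝓕 h x).re ^ 4 + 2 * (𝓕 h x ^ 4).re) :=
          integral_mono hint ((hre.const_mul 48).add (hint4.re.const_mul 2))
            fun x => norm_pow_four_le _
      _ = _ := by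
        have hint4' : Integrable fun x => (𝓕 h x ^ 4).re := hint4.re
        rw [integral_add (hre.const_mul 48) (hint4'.const_mul 2), integral_const_mul,
          integral_const_mul, h0', mul_zero, add_zero]
  have e1 : ∫⁻ x, ‖𝓕 h x‖ₑ ^ 4 = ENNReal.ofReal (∫ x, ‖𝓕 h x‖ ^ 4) := by
    rw [ofReal_integral_eq_lintegral_ofReal hint (Filter.Eventually.of_forall fun x => by
      positivity)]
    refine lintegral_congr fun x => ?_
    rw [ENNReal.ofReal_pow (norm_nonneg _), ofReal_norm]
  have e2 : ∫⁻ x, ‖(𝓕 h x).re‖ₑ ^ 4 = ENNReal.ofReal (∫ x, (𝓕 h x).re ^ 4) := by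
    rw [ofReal_integral_eq_lintegral_ofReal hre (Filter.Eventually.of_forall fun x => by
      positivity)]
    refine lintegral_congr fun x => ?_
    rw [← ofReal_norm, ← ENNReal.ofReal_pow (norm_nonneg _), Real.norm_eq_abs,
      (by decide : Even 4).pow_abs]
  rw [e1, e2]
  refine (ENNReal.ofReal_le_ofReal hmain).trans_eq ?_
  rw [ENNReal.ofReal_mul (by norm_num)]
  norm_num

lemma lintegral_fourierInv_pow_four_le {d : ℕ} {θ : Rd d} (hθ : θ ≠ 0) {h : Rd d → ℂ}
    (h1 : Integrable h) (h2 : MemLp h 2) (hsupp : ∀ ξ, ⟪ξ, θ⟫ ≤ 0 → h ξ = 0) :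
    ∫⁻ x, ‖𝓕⁻ h x‖ₑ ^ 4 ≤ 48 * ∫⁻ x, ‖(𝓕⁻ h x).re‖ₑ ^ 4 := by
  have hmp := Measure.measurePreserving_neg (volume : Measure (Rd d))
  rw [Real.fourierInv_eq_fourier_comp_neg]
  exact lintegral_fourier_pow_four_le (θ := -θ) (neg_ne_zero.2 hθ) h1.comp_neg
    (h2.comp_measurePreserving hmp) fun ξ hξ => hsupp _ (by
      rwa [inner_neg_right, ← inner_neg_left] at hξ)

lemma fourierInv_conj_neg {d : ℕ} (h : Rd d → ℂ) (x : Rd d) :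
    𝓕⁻ (fun ξ => starRingEnd ℂ (h (-ξ))) x = starRingEnd ℂ (𝓕⁻ h x) := by
  simp only [Real.fourierInv_eq]
  rw [← integral_conj, ← integral_neg_eq_self]
  congr 1 with ξ
  simp only [neg_neg, Circle.smul_def, smul_eq_mul, map_mul, inner_neg_left,
    AddChar.map_neg_eq_inv, Circle.coe_inv_eq_conj]

/-- The indicator function of the open half-space `{⟨ξ, θ⟩ > 0}`. -/
def halfInd {d : ℕ} (θ ξ : Rd d) : ℂ := if 0 < ⟪ξ, θ⟫ then 1 else 0

lemma measurable_halfInd {d : ℕ} (θ : Rd d) : Measurable (halfInd θ) :=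
  Measurable.ite (measurableSet_lt measurable_const (by fun_prop)) measurable_const
    measurable_const

lemma norm_halfInd_le {d : ℕ} (θ ξ : Rd d) : ‖halfInd θ ξ‖ ≤ 1 := by
  unfold halfInd
  split_ifs <;> simp

lemma ae_inner_ne_zero {d : ℕ} {θ : Rd d} (hθ : θ ≠ 0) : ∀ᵐ ξ : Rd d, ⟪ξ, θ⟫ ≠ 0 := by
  have h : volume ((ℝ ∙ θ)ᗮ : Set (Rd d)) = 0 := by
    refine Measure.addHaar_submodule _ _ fun ht => hθ ?_
    rw [Submodule.orthogonal_eq_top_iff, Submodule.span_singleton_eq_bot] at ht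
    exact ht
  refine measure_mono_null (fun ξ hξ => ?_) h
  simp only [ne_eq, mem_compl_iff, mem_ofPred_eq, not_not] at hξ
  exact Submodule.mem_orthogonal_singleton_iff_inner_left.2 hξ

/-- For hermitian-symmetrised data, restriction to a half-space is bounded on `L⁴`. -/
lemma eLpNorm_fourierInv_halfInd_symm_le {d : ℕ} {θ : Rd d} (hθ : θ ≠ 0) {h : Rd d → ℂ}
    (h1 : Integrable h) (h2 : MemLp h 2) :
    eLpNorm (𝓕⁻ fun ξ => halfInd θ ξ * ((h ξ + starRingEnd ℂ (h (-ξ))) / 2)) 4 ≤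
      2 * eLpNorm (𝓕⁻ h) 4 := by
  have hmp := Measure.measurePreserving_neg (volume : Measure (Rd d))
  set k : Rd d → ℂ := fun ξ => (h ξ + starRingEnd ℂ (h (-ξ))) / 2 with hk
  have hc1 : Integrable fun ξ => starRingEnd ℂ (h (-ξ)) :=
    (LinearIsometryEquiv.integrable_comp_iff (Complex.conjLIE)).2 h1.comp_neg
  have hc2 : MemLp (fun ξ => starRingEnd ℂ (h (-ξ))) 2 :=
    (h2.comp_measurePreserving hmp).continuousLinearMap_comp
      (Complex.conjCLE : ℂ →L[ℝ] ℂ)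
  have hk1 : Integrable k := (h1.add hc1).div_const 2
  have hk2 : MemLp k 2 := by
    have := (h2.add hc2).const_mul (2⁻¹ : ℂ)
    refine (memLp_congr_ae (Filter.Eventually.of_forall fun ξ => ?_)).1 this
    simp [hk, div_eq_inv_mul]
  have hm := (measurable_halfInd θ).aestronglyMeasurable (μ := volume)
  have hb : ∃ K : ℝ, ∀ ξ, ‖halfInd θ ξ‖ ≤ K := ⟨1, norm_halfInd_le θ⟩
  set k1 : Rd d → ℂ := fun ξ => halfInd θ ξ * k ξ with hk1d
  have hi1 : Integrable k1 := integrable_bdd_mul hm hb hk1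
  have hkey : ∀ x, (𝓕⁻ k1 x).re = 2⁻¹ * (𝓕⁻ h x).re := by
    intro x
    have e1 : 𝓕⁻ k1 x + starRingEnd ℂ (𝓕⁻ k1 x) = 𝓕⁻ k x := by
      have hck : Integrable fun ξ => starRingEnd ℂ (k1 (-ξ)) :=
        (LinearIsometryEquiv.integrable_comp_iff (Complex.conjLIE)).2 hi1.comp_neg
      rw [← fourierInv_conj_neg]
      have := congrFun (fourierInv_add_fun hi1 hck) x
      rw [← this]
      refine congrFun (fourierInv_congr_ae ?_) x
      filter_upwards [ae_inner_ne_zero hθ] with ξ hξ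
      rcases lt_or_gt_of_ne hξ with hlt | hgt
      · simp only [hk1d, hk, halfInd, inner_neg_left, Left.neg_pos_iff, hlt, hlt.not_gt,
          if_true, if_false, map_mul, map_one, neg_neg, map_div₀, map_add, Complex.conj_conj,
          map_ofNat]
        ring
      · simp only [hk1d, hk, halfInd, inner_neg_left, Left.neg_pos_iff, hgt, hgt.not_gt,
          if_true, if_false, map_mul, map_zero]
        ring
    have e2 : 𝓕⁻ k x = (𝓕⁻ h x + starRingEnd ℂ (𝓕⁻ h x)) / 2 := by
      have e3 : k = fun ξ => (2⁻¹ : ℂ) * (h ξ + starRingEnd ℂ (h (-ξ))) := by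
        ext ξ
        simp only [hk]
        ring
      rw [e3, fourierInv_const_mul_fun, fourierInv_add_fun h1 hc1]
      simp only [fourierInv_conj_neg]
      ring
    rw [e2] at e1
    have := congrArg Complex.re e1
    simp at this
    linarith
  have h48 := lintegral_fourierInv_pow_four_le hθ hi1 (memLp_bdd_mul hm hb hk2) fun ξ hξ => by
    simp only [hk1d, halfInd, if_neg (not_lt.2 hξ), zero_mul]
  have key (H : Rd d → ℂ) : eLpNorm H 4 volume ^ 4 = ∫⁻ x, ‖H x‖ₑ ^ 4 := by
    simpa using eLpNorm_pow_eq_lintegral (μ := volume) H 4 (by norm_num)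
  rw [← ENNReal.pow_le_pow_left_iff (n := 4) (by norm_num), mul_pow, key, key]
  refine h48.trans ?_
  have e : ∫⁻ x, ‖(𝓕⁻ k1 x).re‖ₑ ^ 4 ≤ (2⁻¹ : ℝ≥0∞) ^ 4 * ∫⁻ x, ‖𝓕⁻ h x‖ₑ ^ 4 := by
    rw [← lintegral_const_mul' _ _ (by simp)]
    refine lintegral_mono fun x => ?_
    rw [hkey, enorm_mul, mul_pow]
    gcongr
    · rw [enorm_inv (by norm_num)]
      simp [← ofReal_norm]
    · rw [← ofReal_norm, ← ofReal_norm]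
      exact ENNReal.ofReal_le_ofReal (Complex.abs_re_le_norm _)
  calc 48 * ∫⁻ x, ‖(𝓕⁻ k1 x).re‖ₑ ^ 4 ≤ 48 * ((2⁻¹ : ℝ≥0∞) ^ 4 * ∫⁻ x, ‖𝓕⁻ h x‖ₑ ^ 4) := by
        gcongr
    _ = (48 * (2⁻¹ : ℝ≥0∞) ^ 4) * ∫⁻ x, ‖𝓕⁻ h x‖ₑ ^ 4 := by ring
    _ ≤ 2 ^ 4 * ∫⁻ x, ‖𝓕⁻ h x‖ₑ ^ 4 := by
      gcongr
      rw [← ENNReal.inv_pow, ← div_eq_mul_inv]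
      refine ENNReal.div_le_of_le_mul ?_
      norm_num

/-- Half-space multipliers are bounded on `L⁴`, uniformly in the half-space. -/
lemma isMultiplierFour_halfInd {d : ℕ} (θ : Rd d) : IsMultiplierFour 4 (halfInd θ) := by
  refine ⟨measurable_halfInd θ, ⟨1, norm_halfInd_le θ⟩, by norm_num, fun h h1 h2 => ?_⟩
  by_cases hθ : θ = 0
  · have : (fun ξ => halfInd θ ξ * h ξ) = fun _ => 0 := by
      ext ξ; simp [halfInd, hθ]
    have e : 𝓕⁻ (fun _ : Rd d => (0 : ℂ)) = fun _ => 0 := by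
      ext x; simp [Real.fourierInv_eq]
    rw [this, e]
    simp
  have hm := (measurable_halfInd θ).aestronglyMeasurable (μ := volume)
  have hb : ∃ K : ℝ, ∀ ξ, ‖halfInd θ ξ‖ ≤ K := ⟨1, norm_halfInd_le θ⟩
  have hsymm (g : Rd d → ℂ) (g1 : Integrable g) :
      Integrable fun ξ => halfInd θ ξ * ((g ξ + starRingEnd ℂ (g (-ξ))) / 2) := by
    refine integrable_bdd_mul hm hb (Integrable.div_const (g1.add ?_) 2)
    exact (LinearIsometryEquiv.integrable_comp_iff (Complex.conjLIE)).2 g1.comp_neg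
  set k : Rd d → ℂ := fun ξ => -Complex.I * h ξ with hk
  have hk1 : Integrable k := h1.const_mul _
  have hk2 : MemLp k 2 := h2.const_mul _
  have e : (fun ξ => halfInd θ ξ * h ξ) = fun ξ =>
      halfInd θ ξ * ((h ξ + starRingEnd ℂ (h (-ξ))) / 2) +
        Complex.I * (halfInd θ ξ * ((k ξ + starRingEnd ℂ (k (-ξ))) / 2)) := by
    ext ξ
    simp only [hk, map_mul, map_neg, Complex.conj_I]
    linear_combination (-(halfInd θ ξ) * (-h ξ + starRingEnd ℂ (h (-ξ))) / 2) * Complex.I_sq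
  rw [e, fourierInv_add_fun (hsymm h h1) ((hsymm k hk1).const_mul _)]
  have hkn : eLpNorm (𝓕⁻ k) 4 volume = eLpNorm (𝓕⁻ h) 4 volume := by
    rw [hk, fourierInv_const_mul_fun]
    refine (eLpNorm_const_smul (-Complex.I) (𝓕⁻ h) 4 volume).trans ?_
    simp [← ofReal_norm]
  refine (eLpNorm_add_le (continuous_fourierInv (hsymm h h1)).aestronglyMeasurable
    (continuous_fourierInv ((hsymm k hk1).const_mul _)).aestronglyMeasurable
    (by norm_num)).trans ?_
  have e4 : ENNReal.ofReal 4 = 2 + 2 := by norm_num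
  rw [e4, add_mul]
  gcongr
  · exact eLpNorm_fourierInv_halfInd_symm_le hθ h1 h2
  · rw [fourierInv_const_mul_fun]
    refine (eLpNorm_const_smul Complex.I _ 4 volume).le.trans ?_
    have : ‖Complex.I‖ₑ = 1 := by simp [← ofReal_norm]
    rw [this, one_mul, ← hkn]
    exact eLpNorm_fourierInv_halfInd_symm_le hθ hk1 hk2

/-- The indicator function of `{⟨ξ, c⟩ > 0, -R < ⟨ξ, a⟩ / ⟨ξ, c⟩ ≤ R}`. -/
def slopeInd {d : ℕ} (R : ℝ) (c a ξ : Rd d) : ℂ :=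
  if 0 < ⟪ξ, c⟫ ∧ -R < ⟪ξ, a⟫ / ⟪ξ, c⟫ ∧ ⟪ξ, a⟫ / ⟪ξ, c⟫ ≤ R then 1 else 0

lemma halfInd_mul_halfInd {d : ℕ} (c a ξ : Rd d) (t : ℝ) :
    halfInd c ξ * halfInd (a - t • c) ξ = if 0 < ⟪ξ, c⟫ ∧ t < ⟪ξ, a⟫ / ⟪ξ, c⟫ then 1 else 0 := by
  unfold halfInd
  by_cases hc : 0 < ⟪ξ, c⟫
  · have : 0 < ⟪ξ, a - t • c⟫ ↔ t < ⟪ξ, a⟫ / ⟪ξ, c⟫ := by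
      rw [inner_sub_right, real_inner_smul_right, lt_div_iff₀ hc, sub_pos]
    simp [hc, this]
  · simp [hc]

lemma slopeInd_eq {d : ℕ} {R : ℝ} (hR : 0 ≤ R) (c a ξ : Rd d) :
    slopeInd R c a ξ =
      halfInd c ξ * halfInd (a - (-R) • c) ξ - halfInd c ξ * halfInd (a - R • c) ξ := by
  rw [halfInd_mul_halfInd, halfInd_mul_halfInd, slopeInd]
  by_cases hc : 0 < ⟪ξ, c⟫
  · by_cases h1 : -R < ⟪ξ, a⟫ / ⟪ξ, c⟫
    · by_cases h2 : R < ⟪ξ, a⟫ / ⟪ξ, c⟫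
      · simp [hc, h1, h2, not_le.2 h2]
      · simp [hc, h1, h2, not_lt.1 h2]
    · have h2 : ¬ R < ⟪ξ, a⟫ / ⟪ξ, c⟫ := fun h => h1 (by linarith)
      simp [hc, h1, h2]
  · simp [hc]

lemma isMultiplierFour_halfInd_mul {d : ℕ} (c a : Rd d) (t : ℝ) :
    IsMultiplierFour 16 fun ξ => halfInd c ξ * halfInd (a - t • c) ξ :=
  ((isMultiplierFour_halfInd c).mul (isMultiplierFour_halfInd _)).mono (by norm_num)

lemma isMultiplierFour_slopeInd {d : ℕ} {R : ℝ} (hR : 0 ≤ R) (c a : Rd d) :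
    IsMultiplierFour 32 (slopeInd R c a) := by
  have := (isMultiplierFour_halfInd_mul c a (-R)).sub (isMultiplierFour_halfInd_mul c a R)
  rw [funext (slopeInd_eq hR c a)]
  exact this.mono (by norm_num)

lemma norm_slopeInd_le {d : ℕ} (R : ℝ) (c a ξ : Rd d) : ‖slopeInd R c a ξ‖ ≤ 1 := by
  unfold slopeInd
  split_ifs <;> simp

lemma measurable_slopeInd {d : ℕ} (R : ℝ) (c a : Rd d) : Measurable (slopeInd R c a) := by
  refine Measurable.ite ?_ measurable_const measurable_const
  have h1 : Measurable fun ξ : Rd d => ⟪ξ, c⟫ := by fun_prop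
  have h2 : Measurable fun ξ : Rd d => ⟪ξ, a⟫ / ⟪ξ, c⟫ := by fun_prop
  exact (measurableSet_lt measurable_const h1).inter
    ((measurableSet_lt measurable_const h2).inter (measurableSet_le h2 measurable_const))

/-- Characters of the slope `⟨ξ, a⟩ / ⟨ξ, c⟩`, localised to bounded slopes, are `L⁴` multipliers
with norm growing linearly in the frequency. -/
lemma isMultiplierFour_slopeInd_mul_exp {d : ℕ} {R : ℝ} (hR : 0 ≤ R) (c a : Rd d) (k : ℝ) :
    IsMultiplierFour ((32 + 7168 * R) * (1 + |k|)) fun ξ =>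
      slopeInd R c a ξ * Complex.exp (2 * Real.pi * Complex.I * (k * (⟪ξ, a⟫ / ⟪ξ, c⟫) : ℝ)) := by
  set z : ℂ := 2 * Real.pi * Complex.I * k with hz
  have hzn : ‖z‖ = 2 * Real.pi * |k| := by
    simp [hz, abs_of_pos Real.pi_pos]
  set P : ℝ → Rd d → ℂ := fun t ξ => halfInd c ξ * halfInd (a - t • c) ξ with hP
  set M : ℝ → Rd d → ℂ := fun t ξ => z * Complex.exp (z * t) * P t ξ with hM
  have hexp : ∀ t : ℝ, ‖Complex.exp (z * t)‖ = 1 := fun t => by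
    have : z * t = ((2 * Real.pi * k * t : ℝ) : ℂ) * Complex.I := by
      simp only [hz]; push_cast; ring
    rw [this, Complex.norm_exp_ofReal_mul_I]
  have hMt : ∀ t, IsMultiplierFour (16 * (2 * Real.pi * |k| + 1)) (M t) := fun t => by
    refine ((isMultiplierFour_halfInd_mul c a t).const_mul (z * Complex.exp (z * t))).mono ?_
    rw [norm_mul, hexp, hzn]
    linarith
  have hPm : Measurable (Function.uncurry P) := by
    have : Function.uncurry P = fun p : ℝ × Rd d =>
        if 0 < ⟪p.2, c⟫ ∧ p.1 < ⟪p.2, a⟫ / ⟪p.2, c⟫ then 1 else 0 := by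
      ext p; exact halfInd_mul_halfInd c a p.2 p.1
    rw [this]
    refine Measurable.ite ?_ measurable_const measurable_const
    have h1 : Measurable fun p : ℝ × Rd d => ⟪p.2, c⟫ := by fun_prop
    have h2 : Measurable fun p : ℝ × Rd d => ⟪p.2, a⟫ / ⟪p.2, c⟫ := by fun_prop
    exact (measurableSet_lt measurable_const h1).inter (measurableSet_lt measurable_fst h2)
  have hMm : Measurable (Function.uncurry M) := by
    have : Measurable fun p : ℝ × Rd d => z * Complex.exp (z * (p.1 : ℂ)) := by fun_prop
    exact this.mul hPm
  have hint := IsMultiplierFour.integral (μ := volume.restrict (Ioc (-R) R)) hMm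
    (W := fun _ => 16 * (2 * Real.pi * |k| + 1)) (K := fun _ => 2 * Real.pi * |k|)
    measurable_const (fun _ => by positivity) (integrable_const _) (integrable_const _)
    (fun t ξ => by
      simp only [hM, hP, norm_mul, hexp, hzn, mul_one]
      have h1 := norm_halfInd_le c ξ
      have h2 := norm_halfInd_le (a - t • c) ξ
      refine mul_le_of_le_one_right (by positivity) (mul_le_one₀ h1 (norm_nonneg _) h2))
    (Filter.Eventually.of_forall hMt)
  have htot := (isMultiplierFour_slopeInd hR c a).mul
    ((IsMultiplierFour.const (d := d) (Complex.exp (z * (-R : ℝ)))).add hint)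
  have heq : (fun ξ => slopeInd R c a ξ *
      Complex.exp (2 * Real.pi * Complex.I * (k * (⟪ξ, a⟫ / ⟪ξ, c⟫) : ℝ))) = fun ξ =>
      slopeInd R c a ξ * (Complex.exp (z * (-R : ℝ)) + ∫ t in Ioc (-R) R, M t ξ) := by
    ext ξ
    by_cases hw : 0 < ⟪ξ, c⟫ ∧ -R < ⟪ξ, a⟫ / ⟪ξ, c⟫ ∧ ⟪ξ, a⟫ / ⟪ξ, c⟫ ≤ R
    swap
    · simp [slopeInd, hw]
    congr 1
    obtain ⟨hc, h1, h2⟩ := hw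
    set x := ⟪ξ, a⟫ / ⟪ξ, c⟫ with hx
    have e1 : ∫ t in Ioc (-R) R, M t ξ = ∫ t in (-R)..x, z * Complex.exp (z * t) := by
      rw [intervalIntegral.integral_of_le h1.le, integral_Ioc_eq_integral_Ioo (y := x),
        ← integral_indicator measurableSet_Ioo, ← integral_indicator measurableSet_Ioc]
      congr 1 with t
      simp only [hM, hP, halfInd_mul_halfInd, indicator, mem_Ioc, mem_Ioo, ← hx, hc, true_and]
      by_cases ht : t < x
      · simp [ht, (ht.trans_le h2).le]
      · simp [ht]
    have e2 : ∫ t in (-R)..x, z * Complex.exp (z * t) =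
        Complex.exp (z * x) - Complex.exp (z * (-R : ℝ)) := by
      refine intervalIntegral.integral_eq_sub_of_hasDerivAt
        (f := fun t : ℝ => Complex.exp (z * t)) (fun t _ => ?_)
        (Continuous.intervalIntegrable (by fun_prop) _ _)
      have h := ((Complex.ofRealCLM.hasDerivAt (x := t)).const_mul z).cexp
      simpa [mul_comm] using h
    rw [e1, e2, add_sub_cancel]
    congr 1
    simp only [hz]
    push_cast
    ring
  rw [heq]
  refine htot.mono ?_
  rw [hexp]
  simp only [integral_const, MeasurableSet.univ, measureReal_restrict_apply, univ_inter,
    smul_eq_mul]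
  rw [Real.volume_real_Ioc_of_le (by linarith)]
  have hpi := Real.pi_le_four
  have hpi2 := Real.pi_lt_d2
  have hk := abs_nonneg k
  have h1 : R * (Real.pi * |k|) ≤ R * (3.15 * |k|) := by gcongr
  nlinarith [mul_nonneg hR hk]

/-- A Schwartz function of the slopes `⟨ξ, a_l⟩ / ⟨ξ, c⟩`, localised to bounded slopes, is an `L⁴`
multiplier with norm independent of `c` and `a`. -/
lemma exists_isMultiplierFour_schwartz {ι : Type*} [Fintype ι]
    (Ψ : SchwartzMap (EuclideanSpace ℝ ι) ℂ) {R : ℝ} (hR : 0 ≤ R) :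
    ∃ A : ℝ, ∀ (d : ℕ) (c : Rd d) (a : ι → Rd d), IsMultiplierFour A fun ξ =>
      (∏ l, slopeInd R c (a l) ξ) * Ψ (WithLp.toLp 2 fun l => ⟪ξ, a l⟫ / ⟪ξ, c⟫) := by
  set N := Fintype.card ι with hN
  set L : ℝ := 32 + 7168 * R with hL
  have hLpos : 0 < L := by positivity
  set Ψh : SchwartzMap (EuclideanSpace ℝ ι) ℂ := 𝓕 Ψ with hΨh
  obtain ⟨C, hCpos, hC⟩ : ∃ C : ℝ, 0 < C ∧ ∀ k, (1 + ‖k‖) ^ (2 * N + 1) * ‖Ψh k‖ ≤ C := by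
    refine ⟨2 ^ (2 * N + 1) * ((Finset.Iic (2 * N + 1, 0)).sup fun m =>
      SchwartzMap.seminorm ℝ m.1 m.2) Ψh + 1, by positivity, fun k => ?_⟩
    have := SchwartzMap.one_add_le_sup_seminorm_apply (𝕜 := ℝ) (m := (2 * N + 1, 0))
      (k := 2 * N + 1) (n := 0) le_rfl le_rfl Ψh k
    rw [norm_iteratedFDeriv_zero] at this
    linarith
  set W : EuclideanSpace ℝ ι → ℝ := fun k => L ^ N * C * (1 + ‖k‖) ^ (-((N + 1 : ℕ) : ℝ)) with hW
  have hWi : Integrable W := by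
    refine Integrable.const_mul (integrable_one_add_norm ?_) _
    rw [finrank_euclideanSpace]
    push_cast
    linarith
  have hWm : Measurable W := by fun_prop
  have hWb : ∀ k, (L * (1 + ‖k‖)) ^ N * ‖Ψh k‖ ≤ W k := fun k => by
    have h1 : 0 < 1 + ‖k‖ := by positivity
    simp only [hW]
    rw [Real.rpow_neg h1.le, Real.rpow_natCast, mul_pow, mul_assoc, mul_assoc, ← div_eq_mul_inv]
    refine mul_le_mul_of_nonneg_left ?_ (by positivity)
    rw [le_div_iff₀ (by positivity)]
    refine le_trans (le_of_eq ?_) (hC k)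
    ring
  refine ⟨∫ k, W k, fun d c a => ?_⟩
  set X : Rd d → EuclideanSpace ℝ ι := fun ξ => WithLp.toLp 2 fun l => ⟪ξ, a l⟫ / ⟪ξ, c⟫ with hX
  set M : EuclideanSpace ℝ ι → Rd d → ℂ := fun k ξ => Ψh k * ∏ l, (slopeInd R c (a l) ξ *
    Complex.exp (2 * Real.pi * Complex.I * (k l * (⟪ξ, a l⟫ / ⟪ξ, c⟫) : ℝ))) with hM
  have hMm : Measurable (Function.uncurry M) := by
    refine (Ψh.continuous.measurable.comp measurable_fst).mul ?_
    refine Finset.measurable_prod _ fun l _ => ?_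
    refine ((measurable_slopeInd R c (a l)).comp measurable_snd).mul ?_
    fun_prop
  have hexp : ∀ y : ℝ, ‖Complex.exp (2 * Real.pi * Complex.I * y)‖ = 1 := fun y => by
    have : 2 * Real.pi * Complex.I * y = ((2 * Real.pi * y : ℝ) : ℂ) * Complex.I := by
      push_cast; ring
    rw [this, Complex.norm_exp_ofReal_mul_I]
  have hmul := IsMultiplierFour.integral (μ := volume) hMm hWm (K := W)
    (fun k => by positivity) hWi hWi
    (fun k ξ => by
      simp only [hM, norm_mul, norm_prod, hexp, mul_one]
      have h1 : ∏ l, ‖slopeInd R c (a l) ξ‖ ≤ 1 :=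
        Finset.prod_le_one (fun _ _ => norm_nonneg _) fun _ _ => norm_slopeInd_le _ _ _ _
      have h2 : 1 ≤ (L * (1 + ‖k‖)) ^ N := by
        refine one_le_pow₀ ?_
        have : (1 : ℝ) ≤ L := by simp only [hL]; linarith
        nlinarith [norm_nonneg k]
      calc ‖Ψh k‖ * ∏ l, ‖slopeInd R c (a l) ξ‖ ≤ ‖Ψh k‖ * 1 := by gcongr
        _ ≤ (L * (1 + ‖k‖)) ^ N * ‖Ψh k‖ := by nlinarith [norm_nonneg (Ψh k)]
        _ ≤ W k := hWb k)
    (Filter.Eventually.of_forall fun k => by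
      have h1 := IsMultiplierFour.finset_prod Finset.univ fun l (_ : l ∈ Finset.univ) =>
        isMultiplierFour_slopeInd_mul_exp hR c (a l) (k l)
      refine (h1.const_mul (Ψh k)).mono ?_
      rw [mul_comm]
      refine le_trans ?_ (hWb k)
      refine mul_le_mul_of_nonneg_right ?_ (norm_nonneg _)
      refine (Finset.prod_le_prod (g := fun _ => L * (1 + ‖k‖)) (fun _ _ => by positivity)
        fun l _ => ?_).trans ?_
      · have : |k l| ≤ ‖k‖ := PiLp.norm_apply_le k l
        gcongr
      · simp [hN])
  refine (congrArg (IsMultiplierFour (∫ k, W k)) ?_).mp hmul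
  ext ξ
  have hinv : Ψ (X ξ) = ∫ k, Complex.exp (2 * Real.pi * Complex.I * (inner ℝ k (X ξ) : ℝ)) *
      Ψh k := by
    have h1 : Ψ = 𝓕⁻ Ψh := (FourierTransform.fourierInv_fourier_eq Ψ).symm
    have h2 : Ψ (X ξ) = 𝓕⁻ (Ψh : EuclideanSpace ℝ ι → ℂ) (X ξ) := by
      conv_lhs => rw [h1]
      rw [SchwartzMap.fourierInv_coe]
    rw [h2, Real.fourierInv_eq']
    congr 1 with k
    rw [smul_eq_mul]
    congr 2
    push_cast
    ring
  rw [hinv, ← integral_const_mul]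
  congr 1 with k
  simp only [hM, Finset.prod_mul_distrib, ← Complex.exp_sum, ← Finset.mul_sum]
  have hin : (inner ℝ k (X ξ) : ℝ) = ∑ l, k l * (⟪ξ, a l⟫ / ⟪ξ, c⟫) := by
    simp [hX, PiLp.inner_apply, mul_comm]
  rw [hin]
  push_cast
  ring

/-- The direction `σ eᵢ` of a conical coordinate chart of `ℝ^d ∖ {0}`. -/
def chartDir {d : ℕ} (p : Fin d × Bool) : Rd d :=
  EuclideanSpace.single p.1 (if p.2 then 1 else -1)

/-- The remaining coordinate directions of a conical chart (the direction `i` is replaced by `0`). -/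
def chartCoord {d : ℕ} (p : Fin d × Bool) (l : Fin d) : Rd d :=
  if l = p.1 then 0 else EuclideanSpace.single l 1

/-- The indicator function of a conical chart. -/
def chartInd {d : ℕ} (p : Fin d × Bool) (ξ : Rd d) : ℂ :=
  ∏ l, slopeInd 2 (chartDir p) (chartCoord p l) ξ

lemma isMultiplierFour_chartInd {d : ℕ} (p : Fin d × Bool) :
    IsMultiplierFour (∏ _l : Fin d, 32) (chartInd p) :=
  IsMultiplierFour.finset_prod _ fun l _ =>
    isMultiplierFour_slopeInd (by norm_num) (chartDir p) (chartCoord p l)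

lemma inner_chartDir {d : ℕ} (p : Fin d × Bool) (ξ : Rd d) :
    ⟪ξ, chartDir p⟫ = (if p.2 then 1 else -1) * ξ p.1 := by
  simp [chartDir, EuclideanSpace.inner_single_right]

lemma inner_chartCoord {d : ℕ} (p : Fin d × Bool) (l : Fin d) (ξ : Rd d) :
    ⟪ξ, chartCoord p l⟫ = if l = p.1 then 0 else ξ l := by
  unfold chartCoord
  split_ifs <;> simp [EuclideanSpace.inner_single_right]

lemma norm_eq_chart {d : ℕ} (p : Fin d × Bool) (ξ : Rd d) (h : 0 < ⟪ξ, chartDir p⟫) :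
    ‖ξ‖ = ⟪ξ, chartDir p⟫ *
      √(1 + ∑ l, (⟪ξ, chartCoord p l⟫ / ⟪ξ, chartDir p⟫) ^ 2) := by
  set t := ⟪ξ, chartDir p⟫ with ht
  have ht2 : t ^ 2 = ξ p.1 ^ 2 := by
    rw [ht, inner_chartDir]
    split_ifs <;> ring
  have h1 : ‖ξ‖ ^ 2 = (t * √(1 + ∑ l, (⟪ξ, chartCoord p l⟫ / t) ^ 2)) ^ 2 := by
    rw [EuclideanSpace.real_norm_sq_eq, mul_pow, Real.sq_sqrt (by positivity), mul_add, mul_one,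
      Finset.mul_sum]
    have h2 : ∀ l, t ^ 2 * (⟪ξ, chartCoord p l⟫ / t) ^ 2 =
        ξ l ^ 2 - if l = p.1 then ξ p.1 ^ 2 else 0 := fun l => by
      rw [div_pow, mul_div_cancel₀ _ (pow_pos h 2).ne', inner_chartCoord]
      split_ifs with hl
      · simp [hl]
      · simp
    simp only [h2, Finset.sum_sub_distrib, Finset.sum_ite_eq', Finset.mem_univ, if_true]
    rw [ht2]; ring
  exact (pow_left_inj₀ (norm_nonneg _) (mul_nonneg h.le (Real.sqrt_nonneg _)) two_ne_zero).1 h1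

lemma exists_chartInd_eq_one {d : ℕ} {ξ : Rd d} (hξ : ξ ≠ 0) :
    ∃ p : Fin d × Bool, chartInd p ξ = 1 := by
  have hne : Nonempty (Fin d) := by
    by_contra hE
    rw [not_nonempty_iff] at hE
    exact hξ (Subsingleton.elim _ _)
  obtain ⟨i, hi⟩ := Finite.exists_max fun l => |ξ l|
  have hpos : 0 < |ξ i| := by
    refine lt_of_le_of_ne (abs_nonneg _) fun h0 => hξ ?_
    ext l
    have := hi l
    rw [← h0] at this
    simpa using this
  refine ⟨(i, decide (0 < ξ i)), ?_⟩
  have hdir : ⟪ξ, chartDir (i, decide (0 < ξ i))⟫ = |ξ i| := by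
    rw [inner_chartDir]
    by_cases h : 0 < ξ i
    · simp [h, abs_of_pos h]
    · simp [h, abs_of_nonpos (not_lt.1 h)]
  refine Finset.prod_eq_one fun l _ => ?_
  rw [slopeInd, hdir, inner_chartCoord, if_pos]
  refine ⟨hpos, ?_⟩
  split_ifs with hl
  · norm_num
  · have h1 := abs_le.1 (hi l)
    rw [lt_div_iff₀ hpos, div_le_iff₀ hpos]
    constructor <;> linarith [h1.1, h1.2]

/-- Localised to a conical chart, the symbol `Φ(⟨u, ξ/|ξ|⟩)` is an `L⁴` multiplier uniformly
in `u`. -/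
lemma exists_isMultiplierFour_chart {d : ℕ} {Φ : ℝ → ℝ} (hΦ : CutoffHyp Φ)
    (p : Fin d × Bool) :
    ∃ A : ℝ, ∀ u : Rd d,
      IsMultiplierFour A fun ξ => chartInd p ξ * (Φ ⟪u, ‖ξ‖⁻¹ • ξ⟫ : ℂ) := by
  obtain ⟨hsm, -, -, hzero⟩ := hΦ
  set R : ℝ := 5 * √(1 + 4 * d) with hR
  have hR0 : 0 ≤ R := by positivity
  have hR2 : 2 ≤ R := by
    have : 1 ≤ √(1 + 4 * (d : ℝ)) := Real.one_le_sqrt.2 (by linarith [Nat.cast_nonneg (α := ℝ) d])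
    simp only [hR]; linarith
  let χ : ContDiffBump (0 : EuclideanSpace ℝ (Option (Fin d))) :=
    ⟨R * (d + 1) + 1, R * (d + 1) + 2, by positivity, by linarith⟩
  set q : EuclideanSpace ℝ (Option (Fin d)) → ℝ :=
    fun x => √(1 + ∑ l, (x (some l)) ^ 2) with hq
  have hqd : ContDiff ℝ (⊤ : ℕ∞) q := by
    refine ContDiff.sqrt ?_ fun x => by positivity
    fun_prop
  have hq0 : ∀ x, 0 < q x := fun x => by positivity
  set Ψ0 : EuclideanSpace ℝ (Option (Fin d)) → ℂ :=
    fun x => ((χ x * Φ (x none / q x) : ℝ) : ℂ) with hΨ0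
  have hΨd : ContDiff ℝ (⊤ : ℕ∞) Ψ0 := by
    refine Complex.ofRealCLM.contDiff.comp (χ.contDiff.mul (hsm.comp ?_))
    exact ContDiff.div (by fun_prop) hqd fun x => (hq0 x).ne'
  have hΨc : HasCompactSupport Ψ0 := by
    have : HasCompactSupport fun x => χ x * Φ (x none / q x) := χ.hasCompactSupport.mul_right
    exact this.comp_left (g := Complex.ofReal) Complex.ofReal_zero
  obtain ⟨A, hA⟩ := exists_isMultiplierFour_schwartz (hΨc.toSchwartzMap hΨd) hR0
  refine ⟨(∏ _l : Fin d, 32) * A, fun u => ?_⟩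
  have h1 := (isMultiplierFour_chartInd p).mul
    (hA d (chartDir p) fun l => l.elim u (chartCoord p))
  refine (congrArg (IsMultiplierFour ((∏ _l : Fin d, 32) * A)) ?_).mp h1
  ext ξ
  by_cases hch : ∀ l, 0 < ⟪ξ, chartDir p⟫ ∧
      -2 < ⟪ξ, chartCoord p l⟫ / ⟪ξ, chartDir p⟫ ∧ ⟪ξ, chartCoord p l⟫ / ⟪ξ, chartDir p⟫ ≤ 2
  swap
  · push Not at hch
    obtain ⟨l, hl⟩ := hch
    have : chartInd p ξ = 0 := Finset.prod_eq_zero (Finset.mem_univ l) (by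
      rw [slopeInd, if_neg]
      push Not
      exact hl)
    simp [this]
  congr 1
  have hpos : 0 < ⟪ξ, chartDir p⟫ := (hch p.1).1
  set t := ⟪ξ, chartDir p⟫ with ht
  set x : EuclideanSpace ℝ (Option (Fin d)) :=
    WithLp.toLp 2 fun l : Option (Fin d) => ⟪ξ, l.elim u (chartCoord p)⟫ / t with hx
  have hxn : x none = ⟪ξ, u⟫ / t := rfl
  have hxs : ∀ l, x (some l) = ⟪ξ, chartCoord p l⟫ / t := fun l => rfl
  have hnorm : ‖ξ‖ = t * q x := by
    simp only [hq, hxs]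
    exact norm_eq_chart p ξ hpos
  have harg : ⟪u, ‖ξ‖⁻¹ • ξ⟫ = x none / q x := by
    rw [real_inner_smul_right, hnorm, hxn, real_inner_comm]
    have := (hq0 x).ne'
    field_simp
  have hprod : ∏ l : Option (Fin d), slopeInd R (chartDir p) (l.elim u (chartCoord p)) ξ =
      if -R < x none ∧ x none ≤ R then 1 else 0 := by
    rw [Fintype.prod_option]
    have h2 : ∏ l : Fin d, slopeInd R (chartDir p) ((some l).elim u (chartCoord p)) ξ = 1 := by
      refine Finset.prod_eq_one fun l _ => ?_
      rw [slopeInd, if_pos]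
      obtain ⟨a1, a2, a3⟩ := hch l
      exact ⟨a1, by simp only [Option.elim]; linarith,
        by simp only [Option.elim]; linarith⟩
    rw [h2, mul_one, slopeInd, hxn]
    simp [← ht, hpos]
  rw [hprod, harg]
  have hΨx : (hΨc.toSchwartzMap hΨd) x = Ψ0 x := rfl
  rw [hΨx]
  have hs2 : ∀ l, x (some l) ^ 2 ≤ 4 := fun l => by
    obtain ⟨-, a2, a3⟩ := hch l
    rw [hxs]
    nlinarith
  have hsum : ∑ l, x (some l) ^ 2 ≤ 4 * d := by
    refine (Finset.sum_le_sum fun l _ => hs2 l).trans ?_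
    simp [mul_comm]
  by_cases hin : -R < x none ∧ x none ≤ R
  · rw [if_pos hin, one_mul]
    have hball : χ x = 1 := by
      refine χ.one_of_mem_closedBall ?_
      rw [mem_closedBall_zero_iff]
      change ‖x‖ ≤ R * (d + 1) + 1
      have h3 : ‖x‖ ^ 2 ≤ (R * (d + 1) + 1) ^ 2 := by
        rw [EuclideanSpace.real_norm_sq_eq, Fintype.sum_option]
        have h4 : x none ^ 2 ≤ R ^ 2 := by nlinarith [hin.1, hin.2]
        have hd := Nat.cast_nonneg (α := ℝ) d
        have h5 : (4 : ℝ) * d ≤ R ^ 2 * d :=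
          mul_le_mul_of_nonneg_right (by nlinarith) hd
        nlinarith [mul_nonneg hR0 hd, mul_nonneg (sq_nonneg R) hd,
          mul_nonneg (sq_nonneg R) (sq_nonneg (d : ℝ))]
      exact (pow_le_pow_iff_left₀ (norm_nonneg _) (by positivity) two_ne_zero).1 h3
    simp [hΨ0, hball]
  · rw [if_neg hin, zero_mul]
    have hR' : R ≤ |x none| := by
      by_contra hlt
      push Not at hlt
      exact hin ⟨(abs_lt.1 hlt).1, (abs_lt.1 hlt).2.le⟩
    have hbig : 4 < |x none / q x| := by
      rw [abs_div, abs_of_pos (hq0 x), lt_div_iff₀ (hq0 x)]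
      have h6 : q x ≤ √(1 + 4 * d) := Real.sqrt_le_sqrt (by linarith)
      have := hq0 x
      calc 4 * q x < 5 * q x := by linarith
        _ ≤ R := by simp only [hR]; gcongr
        _ ≤ _ := hR'
    rw [hzero _ hbig, Complex.ofReal_zero]

/-- The symbols `Φ(⟨u, ξ/|ξ|⟩)` are `L⁴` multipliers uniformly in `u`. -/
lemma exists_isMultiplierFour_symbol {d : ℕ} {Φ : ℝ → ℝ} (hΦ : CutoffHyp Φ) (hd : 0 < d) :
    ∃ A : ℝ, ∀ u : Rd d, IsMultiplierFour A fun ξ => (Φ ⟪u, ‖ξ‖⁻¹ • ξ⟫ : ℂ) := by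
  classical
  have hcompl (s : Finset (Fin d × Bool)) : ∃ B : ℝ,
      IsMultiplierFour B fun ξ : Rd d => ∏ p ∈ s, (1 - chartInd p ξ) :=
    ⟨_, IsMultiplierFour.finset_prod s fun p _ =>
      (IsMultiplierFour.const 1).sub (isMultiplierFour_chartInd p)⟩
  have hstep (s : Finset (Fin d × Bool)) : ∃ A : ℝ, ∀ u : Rd d, IsMultiplierFour A fun ξ =>
      (1 - ∏ p ∈ s, (1 - chartInd p ξ)) * (Φ ⟪u, ‖ξ‖⁻¹ • ξ⟫ : ℂ) := by
    induction s using Finset.induction_on with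
    | empty => exact ⟨‖(0 : ℂ)‖, fun u => by simpa using IsMultiplierFour.const (d := d) 0⟩
    | insert q s hq ih =>
      obtain ⟨A, hA⟩ := ih
      obtain ⟨B, hB⟩ := hcompl s
      obtain ⟨A', hA'⟩ := exists_isMultiplierFour_chart hΦ q
      refine ⟨A + B * A', fun u => ?_⟩
      refine (congrArg (IsMultiplierFour (A + B * A')) ?_).mp ((hA u).add (hB.mul (hA' u)))
      ext ξ
      rw [Finset.prod_insert hq]
      ring
  obtain ⟨A, hA⟩ := hstep Finset.univ
  refine ⟨A, fun u => (hA u).congr_ae ?_ ⟨1, fun ξ => ?_⟩ ?_⟩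
  · have hc := hΦ.1.continuous
    fun_prop
  · obtain ⟨h0, h1⟩ := hΦ.2.1 ⟪u, ‖ξ‖⁻¹ • ξ⟫
    rw [Complex.norm_real, Real.norm_of_nonneg h0]
    exact h1
  · have : Nontrivial (Rd d) := by
      have : Nonempty (Fin d) := ⟨⟨0, hd⟩⟩
      infer_instance
    have hne : ∀ᵐ ξ : Rd d, ξ ≠ 0 := by
      refine measure_mono_null (t := {0}) (fun ξ hξ => ?_) (measure_singleton _)
      simpa using hξ
    filter_upwards [hne] with ξ hξ
    obtain ⟨p, hp⟩ := exists_chartInd_eq_one hξ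
    rw [Finset.prod_eq_zero (Finset.mem_univ p) (by rw [hp, sub_self]), sub_zero, one_mul]

/-- The Gaussian approximate identity, the Fourier transform of `exp (-b ‖ξ‖²)`. -/
def gaussKer (d : ℕ) (b : ℝ) (t : Rd d) : ℝ :=
  (Real.pi / b) ^ ((d : ℝ) / 2) * Real.exp (-(Real.pi ^ 2 / b) * ‖t‖ ^ 2)

lemma gaussKer_pos {d : ℕ} {b : ℝ} (hb : 0 < b) (t : Rd d) : 0 < gaussKer d b t := by
  have := Real.pi_pos
  unfold gaussKer; positivity

lemma measurable_gaussKer {d : ℕ} (b : ℝ) : Measurable (gaussKer d b) := by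
  unfold gaussKer; fun_prop

lemma lintegral_gaussKer {d : ℕ} {b : ℝ} (hb : 0 < b) :
    ∫⁻ t : Rd d, ENNReal.ofReal (gaussKer d b t) = 1 := by
  have hpi := Real.pi_pos
  have hint : ∫ t : Rd d, gaussKer d b t = 1 := by
    unfold gaussKer
    rw [integral_const_mul, GaussianFourier.integral_rexp_neg_mul_sq_norm (by positivity),
      finrank_euclideanSpace_fin, ← Real.mul_rpow (by positivity) (by positivity)]
    rw [show Real.pi / b * (Real.pi / (Real.pi ^ 2 / b)) = 1 by field_simp, Real.one_rpow]
  have hi : Integrable (gaussKer d b) := by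
    by_contra h
    rw [integral_undef h] at hint
    exact zero_ne_one hint
  rw [← ofReal_integral_eq_lintegral_ofReal hi
    (Filter.Eventually.of_forall fun t => (gaussKer_pos hb t).le), hint, ENNReal.ofReal_one]

lemma fourierInv_gaussian_mul_fourier {d : ℕ} {b : ℝ} (hb : 0 < b) {g : Rd d → ℂ}
    (hg : Integrable g) (x : Rd d) :
    𝓕⁻ (fun ξ => (Real.exp (-b * ‖ξ‖ ^ 2) : ℂ) * 𝓕 g ξ) x =
      ∫ t, (gaussKer d b t : ℂ) * g (x - t) := by
  have hb' : 0 < (b : ℂ).re := by simpa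
  set G : Rd d → ℂ := fun ξ =>
    Complex.exp (-b * ‖ξ‖ ^ 2 + 2 * Real.pi * Complex.I * (⟪x, ξ⟫ : ℝ)) with hG
  have hGi : Integrable G := GaussianFourier.integrable_cexp_neg_mul_sq_norm_add hb' _ _
  have e1 : 𝓕⁻ (fun ξ => (Real.exp (-b * ‖ξ‖ ^ 2) : ℂ) * 𝓕 g ξ) x = ∫ ξ, 𝓕 g ξ * G ξ := by
    rw [Real.fourierInv_eq']
    congr 1 with ξ
    simp only [hG, smul_eq_mul, Complex.exp_add, real_inner_comm x ξ]
    push_cast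
    rw [show ((2:ℂ) * Real.pi * (⟪x, ξ⟫ : ℝ) * Complex.I) =
      2 * Real.pi * Complex.I * (⟪x, ξ⟫ : ℝ) by ring]
    ring
  have e2 : ∀ y, 𝓕 G y = gaussKer d b (x - y) := by
    intro y
    rw [hG, fourier_gaussian_innerProductSpace' hb', finrank_euclideanSpace_fin, gaussKer]
    push_cast
    rw [Complex.ofReal_cpow (by have := Real.pi_pos; positivity)]
    push_cast
    congr 2
    ring
  rw [e1, integral_fourier_mul hg hGi, ← integral_sub_left_eq_self _ volume x]
  congr 1 with t
  rw [e2, sub_sub_cancel, mul_comm]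

lemma eLpNorm_four_fourierInv_gaussian_le {d : ℕ} {b : ℝ} (hb : 0 < b) {g : Rd d → ℂ}
    (hg : Integrable g) :
    eLpNorm (𝓕⁻ fun ξ => (Real.exp (-b * ‖ξ‖ ^ 2) : ℂ) * 𝓕 g ξ) 4 ≤ eLpNorm g 4 := by
  have e : (𝓕⁻ fun ξ => (Real.exp (-b * ‖ξ‖ ^ 2) : ℂ) * 𝓕 g ξ) =
      fun x => ∫ t, (gaussKer d b t : ℂ) * g (x - t) :=
    funext fun x => fourierInv_gaussian_mul_fourier hb hg x
  rw [e]
  have key := eLpNorm_four_integral_le (μ := (volume : Measure (Rd d)))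
    (ν := (volume : Measure (Rd d)))
    (G := fun t x => (gaussKer d b t : ℂ) * g (x - t)) (W := gaussKer d b) (N := eLpNorm g 4)
    ?_ (measurable_gaussKer b) (gaussKer_pos hb) ?_
  · rwa [lintegral_gaussKer hb, one_mul] at key
  · apply AEStronglyMeasurable.mul
    · exact ((Complex.measurable_ofReal.comp (measurable_gaussKer b)).comp
        measurable_fst).aestronglyMeasurable
    · have hq : Measure.QuasiMeasurePreserving (fun z : Rd d × Rd d => z.2 - z.1)
          (volume.prod volume) volume :=
        (quasiMeasurePreserving_sub volume volume).comp
          Measure.measurePreserving_swap.quasiMeasurePreserving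
      exact hg.1.comp_quasiMeasurePreserving hq
  · refine Filter.Eventually.of_forall fun t => ?_
    have h1 : eLpNorm (fun x => (gaussKer d b t : ℂ) * g (x - t)) 4 volume =
        ‖(gaussKer d b t : ℂ)‖ₑ * eLpNorm (fun x => g (x - t)) 4 volume :=
      eLpNorm_const_smul (gaussKer d b t : ℂ) (fun x => g (x - t)) 4 volume
    have h2 : eLpNorm (fun x => g (x - t)) 4 volume = eLpNorm g 4 volume :=
      eLpNorm_comp_measurePreserving hg.1 (measurePreserving_sub_right volume t)
    rw [h1, h2, ← ofReal_norm, Complex.norm_real, Real.norm_of_nonneg (gaussKer_pos hb t).le]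

lemma IsMultiplierFour.eLpNorm_four_le {d : ℕ} {A : ℝ} {m : Rd d → ℂ}
    (hm : IsMultiplierFour A m) {g : Rd d → ℂ} (hg : Integrable g) (hg2 : MemLp g 2)
    (hmg : Integrable fun ξ => m ξ * 𝓕 g ξ) :
    eLpNorm (𝓕⁻ fun ξ => m ξ * 𝓕 g ξ) 4 ≤ ENNReal.ofReal A * eLpNorm g 4 := by
  have hF2 := (memLp_two_fourier hg hg2).1
  set b : ℕ → ℝ := fun n => 1 / ((n : ℝ) + 1) with hb
  have hb0 : ∀ n, 0 < b n := fun n => Nat.one_div_pos_of_nat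
  have hblim : Filter.Tendsto b Filter.atTop (nhds 0) := tendsto_one_div_add_atTop_nhds_zero_nat
  set c : ℕ → Rd d → ℂ := fun n ξ => (Real.exp (-b n * ‖ξ‖ ^ 2) : ℂ) with hc
  have hcm : ∀ n, Measurable (c n) := fun n => by simp only [hc]; fun_prop
  have hc1 : ∀ n ξ, ‖c n ξ‖ ≤ 1 := fun n ξ => by
    simp only [hc, Complex.norm_real, Real.norm_eq_abs, Real.abs_exp, Real.exp_le_one_iff]
    nlinarith [hb0 n, sq_nonneg ‖ξ‖]
  have hci : ∀ n, Integrable (c n) := fun n => by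
    have := GaussianFourier.integrable_cexp_neg_mul_sq_norm_add (V := Rd d) (b := (b n : ℂ))
      (by simpa using hb0 n) 0 0
    refine this.congr (Filter.Eventually.of_forall fun ξ => ?_)
    simp [hc]
  have hFb : ∀ ξ, ‖𝓕 g ξ‖ ≤ ∫ x, ‖g x‖ := fun ξ => by
    rw [Real.fourier_eq]
    refine (norm_integral_le_integral_norm _).trans (le_of_eq ?_)
    simp
  have hh1 : ∀ n, Integrable fun ξ => c n ξ * 𝓕 g ξ := fun n =>
    (hci n).mul_bdd hF2.1 (Filter.Eventually.of_forall hFb)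
  have hh2 : ∀ n, MemLp (fun ξ => c n ξ * 𝓕 g ξ) 2 := fun n =>
    memLp_bdd_mul (hcm n).aestronglyMeasurable ⟨1, hc1 n⟩ hF2
  have hbound : ∀ n, eLpNorm (𝓕⁻ fun ξ => m ξ * (c n ξ * 𝓕 g ξ)) 4 ≤
      ENNReal.ofReal A * eLpNorm g 4 := fun n =>
    (hm.bound _ (hh1 n) (hh2 n)).trans (by
      gcongr
      exact eLpNorm_four_fourierInv_gaussian_le (hb0 n) hg)
  have hlim : ∀ x, Filter.Tendsto (fun n => 𝓕⁻ (fun ξ => m ξ * (c n ξ * 𝓕 g ξ)) x)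
      Filter.atTop (nhds (𝓕⁻ (fun ξ => m ξ * 𝓕 g ξ) x)) := by
    intro x
    simp only [Real.fourierInv_eq]
    refine tendsto_integral_of_dominated_convergence (fun ξ => ‖m ξ * 𝓕 g ξ‖) ?_ hmg.norm ?_ ?_
    · intro n
      have := (Real.fourierIntegral_convergent_iff (-x)).2 (hm.integrable_mul (hh1 n))
      simpa using this.1
    · refine fun n => Filter.Eventually.of_forall fun ξ => ?_
      rw [Circle.norm_smul, mul_left_comm, norm_mul]
      exact mul_le_of_le_one_left (norm_nonneg _) (hc1 n ξ)
    · refine Filter.Eventually.of_forall fun ξ => ?_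
      have h1 : Filter.Tendsto (fun n => c n ξ) Filter.atTop (nhds 1) := by
        have : Filter.Tendsto (fun n => Real.exp (-b n * ‖ξ‖ ^ 2)) Filter.atTop (nhds 1) := by
          have := (Real.continuous_exp.tendsto _).comp (hblim.neg.mul_const (‖ξ‖ ^ 2))
          simpa [Function.comp_def] using this
        have h2 := (Complex.continuous_ofReal.tendsto _).comp this
        simpa only [Function.comp_def, Complex.ofReal_one] using h2
      have h2 := ((h1.mul_const (𝓕 g ξ)).const_mul (m ξ)).const_smul (Real.fourierChar ⟪ξ, x⟫)
      simpa using h2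
  refine (Lp.eLpNorm_lim_le_liminf_eLpNorm (fun n => ?_) _
    (Filter.Eventually.of_forall hlim)).trans ?_
  · exact (continuous_fourierInv (hm.integrable_mul (hh1 n))).aestronglyMeasurable
  · exact Filter.liminf_le_of_le (by isBoundedDefault) fun a ha => by
      obtain ⟨n, hn⟩ := ha.exists
      exact hn.trans (hbound n)

lemma eLpNorm_two_fourierInv_mul_le {d : ℕ} {m : Rd d → ℂ} (hmm : Measurable m)
    (hm1 : ∀ ξ, ‖m ξ‖ ≤ 1) {g : Rd d → ℂ} (hg : Integrable g) (hg2 : MemLp g 2)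
    (hmg : Integrable fun ξ => m ξ * 𝓕 g ξ) :
    eLpNorm (𝓕⁻ fun ξ => m ξ * 𝓕 g ξ) 2 ≤ eLpNorm g 2 := by
  have hF := memLp_two_fourier hg hg2
  have h2 : MemLp (fun ξ => m ξ * 𝓕 g ξ) 2 :=
    memLp_bdd_mul hmm.aestronglyMeasurable ⟨1, hm1⟩ hF.1
  rw [(memLp_two_fourierInv hmg h2).2, ← hF.2]
  refine eLpNorm_mono fun ξ => ?_
  rw [norm_mul]
  exact mul_le_of_le_one_left (norm_nonneg _) (hm1 ξ)

lemma lintegral_pow_three_le {α : Type*} [MeasurableSpace α] {μ : Measure α} {f : α → ℝ≥0∞}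
    (hf : AEMeasurable f μ) :
    ∫⁻ x, f x ^ 3 ∂μ ≤ (∫⁻ x, f x ^ 2 ∂μ) ^ (1 / 2 : ℝ) * (∫⁻ x, f x ^ 4 ∂μ) ^ (1 / 2 : ℝ) := by
  have h := ENNReal.lintegral_mul_le_Lp_mul_Lq μ (p := 2) (q := 2)
    (by rw [Real.holderConjugate_iff]; norm_num) hf (hf.pow_const 2)
  have e1 : ∀ x, (f * fun x => f x ^ 2) x = f x ^ 3 := fun x => by
    simp only [Pi.mul_apply]; ring
  have e2 : ∀ x, (f x ^ 2) ^ (2 : ℝ) = f x ^ 4 := fun x => by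
    rw [ENNReal.rpow_ofNat]; ring
  simpa only [e1, e2, ENNReal.rpow_ofNat] using h

/-- The `L³` bound for a Fourier multiplier bounded on `L²` and on `L⁴`. -/
lemma IsMultiplierFour.lintegral_pow_three_le {d : ℕ} {A : ℝ} {m : Rd d → ℂ}
    (hm : IsMultiplierFour A m) (hm1 : ∀ ξ, ‖m ξ‖ ≤ 1) {g : Rd d → ℂ} (hg : Integrable g)
    (hg2 : MemLp g 2) (hmg : Integrable fun ξ => m ξ * 𝓕 g ξ) {B₂ B₄ : ℝ≥0∞}
    (h2 : ∫⁻ x, ‖g x‖ₑ ^ 2 ≤ B₂) (h4 : ∫⁻ x, ‖g x‖ₑ ^ 4 ≤ B₄) :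
    ∫⁻ x, ‖𝓕⁻ (fun ξ => m ξ * 𝓕 g ξ) x‖ₑ ^ 3 ≤
      ENNReal.ofReal A ^ 2 * (B₂ ^ (1 / 2 : ℝ) * B₄ ^ (1 / 2 : ℝ)) := by
  have key2 (H : Rd d → ℂ) : eLpNorm H 2 ^ 2 = ∫⁻ x, ‖H x‖ₑ ^ 2 := by
    simpa using eLpNorm_pow_eq_lintegral (μ := volume) H 2 (by norm_num)
  have key4 (H : Rd d → ℂ) : eLpNorm H 4 ^ 4 = ∫⁻ x, ‖H x‖ₑ ^ 4 := by
    simpa using eLpNorm_pow_eq_lintegral (μ := volume) H 4 (by norm_num)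
  have n2 : ∫⁻ x, ‖𝓕⁻ (fun ξ => m ξ * 𝓕 g ξ) x‖ₑ ^ 2 ≤ B₂ := by
    rw [← key2]
    refine le_trans ?_ ((key2 g).trans_le h2)
    gcongr
    exact eLpNorm_two_fourierInv_mul_le hm.measurable hm1 hg hg2 hmg
  have n4 : ∫⁻ x, ‖𝓕⁻ (fun ξ => m ξ * 𝓕 g ξ) x‖ₑ ^ 4 ≤ ENNReal.ofReal A ^ 4 * B₄ := by
    rw [← key4]
    refine le_trans ?_ (mul_le_mul_right ((key4 g).trans_le h4) (ENNReal.ofReal A ^ 4))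
    rw [← mul_pow]
    gcongr
    exact hm.eLpNorm_four_le hg hg2 hmg
  refine (_root_.lintegral_pow_three_le
    (continuous_fourierInv hmg).measurable.enorm.aemeasurable).trans ?_
  calc _ ≤ B₂ ^ (1 / 2 : ℝ) * (ENNReal.ofReal A ^ 4 * B₄) ^ (1 / 2 : ℝ) := by gcongr
    _ = _ := by
      rw [ENNReal.mul_rpow_of_nonneg _ _ (by norm_num), ← ENNReal.rpow_natCast,
        ← ENNReal.rpow_mul, show ((4:ℕ):ℝ) * (1/2) = 2 by norm_num, ENNReal.rpow_ofNat]
      ring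

/-- The normalized integral of `β` over the ball of radius `r` about `x`. -/
def ballMean (d : ℕ) (r : ℝ) (β : Rd d → ℝ≥0∞) (x : Rd d) : ℝ≥0∞ :=
  ENNReal.ofReal (r ^ d)⁻¹ * ∫⁻ z in ball x r, β z

lemma measurable_ball_kernel {d : ℕ} (r : ℝ) {β : Rd d → ℝ≥0∞} (hβ : Measurable β) :
    Measurable fun p : Rd d × Rd d => (ball p.1 r).indicator β p.2 := by
  have h : (fun p : Rd d × Rd d => (ball p.1 r).indicator β p.2) =
      {p : Rd d × Rd d | dist p.2 p.1 < r}.indicator fun p => β p.2 := by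
    ext p
    by_cases hp : dist p.2 p.1 < r
    · rw [indicator_of_mem (mem_ball.2 hp), indicator_of_mem (by exact hp)]
    · rw [indicator_of_notMem (by rwa [mem_ball]), indicator_of_notMem (by exact hp)]
  rw [h]
  exact (hβ.comp measurable_snd).indicator
    (measurableSet_lt (measurable_snd.dist measurable_fst) measurable_const)

lemma measurable_ballMean {d : ℕ} (r : ℝ) {β : Rd d → ℝ≥0∞} (hβ : Measurable β) :
    Measurable (ballMean d r β) := by
  refine Measurable.const_mul ?_ _
  simp_rw [← lintegral_indicator measurableSet_ball]
  exact (measurable_ball_kernel r hβ).lintegral_prod_right'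

lemma setLIntegral_ballMean_mul_le {d : ℕ} (r : ℝ) {β u : Rd d → ℝ≥0∞} (hβ : Measurable β)
    (hu : Measurable u) {A A' : Set (Rd d)} (hA : MeasurableSet A) (hA' : MeasurableSet A')
    (hAA : ∀ x ∈ A, ball x r ⊆ A') :
    ∫⁻ x in A, ballMean d r β x * u x ≤
      ENNReal.ofReal (r ^ d)⁻¹ * ∫⁻ z in A', β z * ∫⁻ x in ball z r, u x := by
  have hk := measurable_ball_kernel r hβ
  calc ∫⁻ x in A, ballMean d r β x * u x
      = ∫⁻ x, ENNReal.ofReal (r ^ d)⁻¹ *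
          ∫⁻ z, A.indicator 1 x * u x * (ball x r).indicator β z := by
        rw [← lintegral_indicator hA]
        congr 1 with x
        rw [lintegral_const_mul _ (hβ.indicator measurableSet_ball),
          lintegral_indicator measurableSet_ball]
        by_cases hx : x ∈ A
        · simp only [indicator_of_mem hx, ballMean, Pi.one_apply]; ring
        · simp [indicator_of_notMem hx]
    _ = ENNReal.ofReal (r ^ d)⁻¹ *
          ∫⁻ x, ∫⁻ z, A.indicator 1 x * u x * (ball x r).indicator β z := by
        rw [lintegral_const_mul' _ _ ENNReal.ofReal_ne_top]
    _ = ENNReal.ofReal (r ^ d)⁻¹ *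
          ∫⁻ z, ∫⁻ x, A.indicator 1 x * u x * (ball x r).indicator β z := by
        rw [lintegral_lintegral_swap]
        exact ((((measurable_const.indicator hA).mul hu).comp measurable_fst).mul hk).aemeasurable
    _ ≤ ENNReal.ofReal (r ^ d)⁻¹ * ∫⁻ z, A'.indicator (fun z => β z * ∫⁻ x in ball z r, u x) z := by
        gcongr with z
        by_cases hz : z ∈ A'
        · rw [indicator_of_mem hz, ← lintegral_indicator measurableSet_ball,
            ← lintegral_const_mul _ (hu.indicator measurableSet_ball)]
          refine lintegral_mono fun x => ?_
          by_cases hx : z ∈ ball x r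
          · rw [indicator_of_mem hx, indicator_of_mem (mem_ball_comm.1 hx), mul_comm]
            gcongr
            refine mul_le_of_le_one_left' (indicator_le_self' (by simp) _)
          · simp [indicator_of_notMem hx]
        · rw [indicator_of_notMem hz]
          refine le_of_eq ?_
          rw [lintegral_eq_zero_iff']
          · refine Filter.Eventually.of_forall fun x => ?_
            by_cases hx : x ∈ A
            · simp [indicator_of_notMem (fun h => hz (hAA x hx h))]
            · simp [indicator_of_notMem hx]
          · exact (((measurable_const.indicator hA).mul hu).mul
              (hk.comp (measurable_id.prodMk measurable_const))).aemeasurable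
    _ = _ := by rw [lintegral_indicator hA']

lemma add_pow_le_add_mul_pow (a h : ℝ≥0∞) (n : ℕ) :
    (a + h) ^ (n + 1) ≤ a ^ (n + 1) + (n + 1) * (h * (a + h) ^ n) := by
  induction n with
  | zero => simp
  | succ n ih =>
    calc (a + h) ^ (n + 1 + 1) = (a + h) ^ (n + 1) * a + h * (a + h) ^ (n + 1) := by ring
      _ ≤ (a ^ (n + 1) + (n + 1) * (h * (a + h) ^ n)) * a + h * (a + h) ^ (n + 1) := by gcongr
      _ = a ^ (n + 1 + 1) + (n + 1) * (h * ((a + h) ^ n * a)) + h * (a + h) ^ (n + 1) := by ring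
      _ ≤ a ^ (n + 1 + 1) + (n + 1) * (h * ((a + h) ^ n * (a + h))) + h * (a + h) ^ (n + 1) := by
        gcongr; exact le_self_add
      _ = _ := by push_cast; ring

lemma sum_range_pow_le (h : ℕ → ℝ≥0∞) (n k : ℕ) :
    (∑ i ∈ Finset.range k, h i) ^ (n + 1) ≤
      (n + 1) * ∑ i ∈ Finset.range k, h i * (∑ l ∈ Finset.range (i + 1), h l) ^ n := by
  induction k with
  | zero => simp
  | succ k ih =>
    rw [Finset.sum_range_succ, Finset.sum_range_succ (fun i => h i * _), mul_add]
    refine (add_pow_le_add_mul_pow _ _ _).trans ?_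
    rw [Finset.sum_range_succ]
    gcongr

section BallMeanSum

variable {d : ℕ} {r : ℕ → ℝ} {β : ℕ → Rd d → ℝ≥0∞} {D : ℝ≥0∞}

/-- The partial sums of the ball means of `β i` at scale `r i`. -/
def ballMeanSum (r : ℕ → ℝ) (β : ℕ → Rd d → ℝ≥0∞) (k : ℕ) (x : Rd d) : ℝ≥0∞ :=
  ∑ i ∈ Finset.range k, ballMean d (r i) (β i) x

lemma measurable_ballMeanSum (hβ : ∀ i, Measurable (β i)) (k : ℕ) :
    Measurable (ballMeanSum r β k) :=
  Finset.measurable_sum _ fun i _ => measurable_ballMean (r i) (hβ i)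

lemma setLIntegral_ballMeanSum_pow_succ_le (hr : ∀ i, 0 < r i) (hβ : ∀ i, Measurable (β i))
    {n k : ℕ} {E : ℝ≥0∞} {A A' : Set (Rd d)} (hA : MeasurableSet A) (hA' : MeasurableSet A')
    (hAA : ∀ i < k, ∀ x ∈ A, ball x (r i) ⊆ A')
    (hE : ∀ i y, ∫⁻ x in ball y (r i), ballMeanSum r β (i + 1) x ^ n ≤
      E * ENNReal.ofReal (r i ^ d)) :
    ∫⁻ x in A, ballMeanSum r β k x ^ (n + 1) ≤
      (n + 1) * E * ∑ i ∈ Finset.range k, ∫⁻ z in A', β i z := by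
  have hS := fun i => (measurable_ballMeanSum (r := r) hβ (i + 1)).pow_const n
  calc ∫⁻ x in A, ballMeanSum r β k x ^ (n + 1)
      ≤ ∫⁻ x in A, (n + 1) * ∑ i ∈ Finset.range k,
          ballMean d (r i) (β i) x * ballMeanSum r β (i + 1) x ^ n :=
        lintegral_mono fun x => sum_range_pow_le (fun i => ballMean d (r i) (β i) x) n k
    _ = (n + 1) * ∑ i ∈ Finset.range k,
          ∫⁻ x in A, ballMean d (r i) (β i) x * ballMeanSum r β (i + 1) x ^ n := by
        rw [lintegral_const_mul' _ _ (by finiteness), lintegral_finsetSum]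
        exact fun i _ => (measurable_ballMean (r i) (hβ i)).mul (hS i)
    _ ≤ (n + 1) * ∑ i ∈ Finset.range k, E * ∫⁻ z in A', β i z := by
        gcongr with i hi
        refine (setLIntegral_ballMean_mul_le (r i) (hβ i) (hS i) hA hA'
          (hAA i (Finset.mem_range.1 hi))).trans ?_
        have hri : 0 < r i ^ d := pow_pos (hr i) d
        calc _ ≤ ENNReal.ofReal (r i ^ d)⁻¹ *
              ∫⁻ z in A', β i z * (E * ENNReal.ofReal (r i ^ d)) := by
              gcongr with z
              exact hE i z
          _ = (ENNReal.ofReal (r i ^ d)⁻¹ * ENNReal.ofReal (r i ^ d)) *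
              (E * ∫⁻ z in A', β i z) := by
              rw [lintegral_mul_const _ (hβ i)]; ring
          _ = E * ∫⁻ z in A', β i z := by
              rw [← ENNReal.ofReal_mul (by positivity), inv_mul_cancel₀ hri.ne',
                ENNReal.ofReal_one, one_mul]
    _ = _ := by rw [← Finset.mul_sum]; ring

lemma setLIntegral_ball_ballMeanSum_pow_le (hr : ∀ i, 0 < r i) (hmono : Monotone r)
    (hβ : ∀ i, Measurable (β i))
    (hD : ∀ k y, ∑ i ∈ Finset.range (k + 1), ∫⁻ z in ball y (2 * r k), β i z ≤
      D * ENNReal.ofReal (r k ^ d)) (n k : ℕ) (y : Rd d) :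
    ∫⁻ x in ball y (r k), ballMeanSum r β (k + 1) x ^ n ≤
      (n.factorial * D ^ n * volume (ball (0 : Rd d) 1)) * ENNReal.ofReal (r k ^ d) := by
  induction n generalizing k y with
  | zero =>
    simp [Measure.addHaar_ball_of_pos _ y (hr k), mul_comm]
  | succ n ih =>
    refine (setLIntegral_ballMeanSum_pow_succ_le hr hβ (A' := ball y (2 * r k))
      measurableSet_ball measurableSet_ball (fun i hi x hx => ?_) ih).trans ?_
    · refine ball_subset_ball' ?_
      have := hmono (Nat.lt_succ_iff.1 hi)
      rw [mem_ball] at hx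
      linarith
    · refine (mul_le_mul_right (hD k y) _).trans (le_of_eq ?_)
      rw [Nat.factorial_succ]
      push_cast
      ring

lemma lintegral_ballMeanSum_pow_succ_le (hr : ∀ i, 0 < r i) (hmono : Monotone r)
    (hβ : ∀ i, Measurable (β i))
    (hD : ∀ k y, ∑ i ∈ Finset.range (k + 1), ∫⁻ z in ball y (2 * r k), β i z ≤
      D * ENNReal.ofReal (r k ^ d)) (n k : ℕ) :
    ∫⁻ x, ballMeanSum r β k x ^ (n + 1) ≤
      ((n + 1).factorial * D ^ n * volume (ball (0 : Rd d) 1)) *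
        ∑ i ∈ Finset.range k, ∫⁻ z, β i z := by
  have h := setLIntegral_ballMeanSum_pow_succ_le (n := n) (k := k) hr hβ MeasurableSet.univ
    MeasurableSet.univ (fun _ _ _ _ => subset_univ _)
    (setLIntegral_ball_ballMeanSum_pow_le hr hmono hβ hD n)
  simp only [setLIntegral_univ] at h
  refine h.trans (le_of_eq ?_)
  rw [Nat.factorial_succ]
  push_cast
  ring

end BallMeanSum

/-- The open dyadic cube with the same corners as `dcube d 0 k m`. -/
def openCube (d : ℕ) (q : ℤ × (Fin d → ℤ)) : Set (Rd d) :=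
  {x | ∀ i : Fin d, x i ∈ Ioo ((2:ℝ) ^ q.1 * q.2 i) ((2:ℝ) ^ q.1 * (q.2 i + 1))}

lemma openCube_subset_dcube {d : ℕ} (q : ℤ × (Fin d → ℤ)) :
    openCube d q ⊆ dcube d 0 q.1 q.2 := by
  intro x hx i
  have := hx i
  simp only [Pi.zero_apply, zero_add]
  exact ⟨this.1.le, this.2⟩

lemma isOpen_openCube {d : ℕ} (q : ℤ × (Fin d → ℤ)) : IsOpen (openCube d q) := by
  have h : openCube d q = ⋂ i : Fin d, (fun x : Rd d => x i) ⁻¹'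
      Ioo ((2:ℝ) ^ q.1 * q.2 i) ((2:ℝ) ^ q.1 * (q.2 i + 1)) := by
    ext x; simp [openCube]
  rw [h]
  exact isOpen_iInter_of_finite fun i => isOpen_Ioo.preimage (by fun_prop)

lemma volume_dcube {d : ℕ} (q : ℤ × (Fin d → ℤ)) :
    volume (dcube d 0 q.1 q.2) = volume (openCube d q) := by
  have h1 : dcube d 0 q.1 q.2 = WithLp.ofLp ⁻¹' (univ.pi fun i =>
      Ico ((2:ℝ) ^ q.1 * q.2 i) ((2:ℝ) ^ q.1 * (q.2 i + 1))) := by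
    ext x; simp [dcube]
  have h2 : openCube d q = WithLp.ofLp ⁻¹' (univ.pi fun i =>
      Ioo ((2:ℝ) ^ q.1 * q.2 i) ((2:ℝ) ^ q.1 * (q.2 i + 1))) := by
    ext x; simp [openCube]
  rw [h1, h2, (PiLp.volume_preserving_ofLp (Fin d)).measure_preimage
      (MeasurableSet.univ_pi fun _ => measurableSet_Ico).nullMeasurableSet,
    (PiLp.volume_preserving_ofLp (Fin d)).measure_preimage
      (MeasurableSet.univ_pi fun _ => measurableSet_Ioo).nullMeasurableSet,
    Real.volume_pi_Ioo, Real.volume_pi_Ico]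

lemma dist_le_of_mem_dcube {d : ℕ} (q : ℤ × (Fin d → ℤ)) {x y : Rd d}
    (hx : x ∈ dcube d 0 q.1 q.2) (hy : y ∈ dcube d 0 q.1 q.2) : dist x y ≤ d * (2:ℝ) ^ q.1 := by
  have h2 : (0:ℝ) < (2:ℝ) ^ q.1 := by positivity
  rw [EuclideanSpace.dist_eq, Real.sqrt_le_iff]
  refine ⟨by positivity, ?_⟩
  have h (i : Fin d) : dist (x i) (y i) ^ 2 ≤ ((2:ℝ) ^ q.1) ^ 2 := by
    have h1 := hx i
    have h3 := hy i
    rw [Real.dist_eq, sq_abs]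
    apply sq_le_sq'
    · linarith [h1.1, h3.2]
    · linarith [h1.2, h3.1]
  calc ∑ i, dist (x i) (y i) ^ 2 ≤ ∑ _i : Fin d, ((2:ℝ) ^ q.1) ^ 2 :=
        Finset.sum_le_sum fun i _ => h i
    _ = d * ((2:ℝ) ^ q.1) ^ 2 := by simp
    _ ≤ (d * (2:ℝ) ^ q.1) ^ 2 := by
      rw [mul_pow]
      gcongr
      exact_mod_cast Nat.le_self_pow two_ne_zero d

/-- The sum of the absolute values of the bad functions of sidelength `2 ^ m`. -/
def badAbs {d : ℕ} (Qset : Set (ℤ × (Fin d → ℤ))) (b : ℤ × (Fin d → ℤ) → Rd d → ℝ)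
    (m : ℤ) (x : Rd d) : ℝ≥0∞ :=
  ∑' mv : Fin d → ℤ, ‖Qset.indicator (fun q => b q x) (m, mv)‖ₑ

section BadAbs

variable {d : ℕ} {Qset : Set (ℤ × (Fin d → ℤ))} {b : ℤ × (Fin d → ℤ) → Rd d → ℝ} {α : ℝ}

lemma enorm_bsum_le (m : ℤ) (x : Rd d) : ‖bsum d Qset b m x‖ₑ ≤ badAbs Qset b m x :=
  enorm_tsum_le_tsum_enorm

lemma BadFam.aemeasurable_indicator (hb : BadFam d Qset b α) (q : ℤ × (Fin d → ℤ)) :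
    AEMeasurable fun x => ‖Qset.indicator (fun q => b q x) q‖ₑ := by
  by_cases hq : q ∈ Qset
  · simp only [indicator_of_mem hq]
    exact (hb.2.2.1 q hq).1.enorm
  · simp [indicator_of_notMem hq]

lemma BadFam.aemeasurable_badAbs (hb : BadFam d Qset b α) (m : ℤ) :
    AEMeasurable (badAbs Qset b m) :=
  AEMeasurable.tsum fun mv => hb.aemeasurable_indicator (m, mv)

lemma BadFam.sum_setLIntegral_badAbs_le_tsum (hb : BadFam d Qset b α) (M : Finset ℤ)
    (S : Set (Rd d)) {F : ℤ × (Fin d → ℤ) → ℝ≥0∞}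
    (hF : ∀ q, q.1 ∈ M → q ∈ Qset → ∫⁻ x in S, ‖b q x‖ₑ ≤ F q) :
    ∑ m ∈ M, ∫⁻ x in S, badAbs Qset b m x ≤ ∑' q, F q := by
  rw [ENNReal.tsum_prod']
  refine le_trans (Finset.sum_le_sum fun m hm => ?_) (ENNReal.sum_le_tsum M)
  unfold badAbs
  rw [lintegral_tsum fun mv => (hb.aemeasurable_indicator (m, mv)).restrict]
  refine ENNReal.tsum_le_tsum fun mv => ?_
  by_cases hq : (m, mv) ∈ Qset
  · simpa only [indicator_of_mem hq] using hF _ hm hq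
  · simp [indicator_of_notMem hq]

lemma BadFam.sum_lintegral_badAbs_le (hb : BadFam d Qset b α) (M : Finset ℤ) :
    ∑ m ∈ M, ∫⁻ x, badAbs Qset b m x ≤ ∑' q : Qset, ENNReal.ofReal (∫ x, |b q.1 x|) := by
  rw [tsum_subtype Qset fun q => ENNReal.ofReal (∫ x, |b q x|)]
  have h := hb.sum_setLIntegral_badAbs_le_tsum M univ
    (F := Qset.indicator fun q => ENNReal.ofReal (∫ x, |b q x|)) fun q _ hq => by
      rw [indicator_of_mem hq, setLIntegral_univ]
      exact (ofReal_integral_norm_eq_lintegral_enorm (hb.2.2.1 q hq)).ge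
  simpa only [setLIntegral_univ] using h

lemma BadFam.setLIntegral_enorm_le (hb : BadFam d Qset b α) (hα : 0 < α)
    {q : ℤ × (Fin d → ℤ)} (hq : q ∈ Qset) (S : Set (Rd d)) :
    ∫⁻ x in S, ‖b q x‖ₑ ≤ ENNReal.ofReal α * volume (openCube d q) := by
  refine (setLIntegral_le_lintegral _ _).trans ?_
  rw [← ofReal_integral_norm_eq_lintegral_enorm (hb.2.2.1 q hq)]
  refine (ENNReal.ofReal_le_ofReal (hb.2.2.2 q hq)).trans ?_
  rw [ENNReal.ofReal_mul hα.le, volume_dcube]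
  gcongr
  exact ENNReal.ofReal_toReal_le

open Classical in
/-- The packing estimate for the bad functions of sidelength at most `ρ`. -/
lemma BadFam.sum_setLIntegral_ball_badAbs_le (hb : BadFam d Qset b α) (hα : 0 < α) {ρ : ℝ}
    (hρ : 0 < ρ) (M : Finset ℤ) (hM : ∀ m ∈ M, (2:ℝ) ^ m ≤ ρ) (y : Rd d) :
    ∑ m ∈ M, ∫⁻ x in ball y (2 * ρ), badAbs Qset b m x ≤
      ENNReal.ofReal (α * (d + 2) ^ d) * volume (ball (0 : Rd d) 1) * ENNReal.ofReal (ρ ^ d) := by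
  set P : ℤ × (Fin d → ℤ) → Prop := fun q =>
    q ∈ Qset ∧ q.1 ∈ M ∧ (dcube d 0 q.1 q.2 ∩ ball y (2 * ρ)).Nonempty with hP
  set U : ℤ × (Fin d → ℤ) → Set (Rd d) := fun q => if P q then openCube d q else ∅ with hU
  have h1 := hb.sum_setLIntegral_badAbs_le_tsum M (ball y (2 * ρ))
    (F := fun q => ENNReal.ofReal α * volume (U q)) fun q hqM hq => by
      by_cases hne : (dcube d 0 q.1 q.2 ∩ ball y (2 * ρ)).Nonempty
      · simp only [hU, hP, hq, hqM, hne, and_self, if_true]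
        exact hb.setLIntegral_enorm_le hα hq _
      · rw [setLIntegral_congr_fun (g := fun _ => 0) measurableSet_ball]
        · simp
        · intro x hx
          have : x ∉ dcube d 0 q.1 q.2 := fun h => hne ⟨x, h, hx⟩
          have : b q x = 0 := Function.notMem_support.1 fun h => this (hb.2.1 q hq h)
          simp [this]
  refine h1.trans ?_
  have hUm : ∀ q, MeasurableSet (U q) := fun q => by
    simp only [hU]; split_ifs
    · exact (isOpen_openCube q).measurableSet
    · exact MeasurableSet.empty
  have hUd : Pairwise (Function.onFun Disjoint U) := by
    intro q q' hne
    simp only [Function.onFun, hU]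
    split_ifs with h h'
    · exact (hb.1 h.1 h'.1 hne).mono
        (interior_maximal (openCube_subset_dcube q) (isOpen_openCube q))
        (interior_maximal (openCube_subset_dcube q') (isOpen_openCube q'))
    all_goals simp
  have hUs : ⋃ q, U q ⊆ ball y ((d + 2) * ρ) := by
    refine iUnion_subset fun q x hx => ?_
    simp only [hU] at hx
    split_ifs at hx with h
    · obtain ⟨-, hqM, z, hz, hzb⟩ := h
      have h3 := dist_le_of_mem_dcube q (openCube_subset_dcube q hx) hz
      rw [mem_ball] at hzb ⊢
      have h4 : d * (2:ℝ) ^ q.1 ≤ d * ρ := by gcongr; exact hM _ hqM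
      linarith [dist_triangle x z y]
    · exact hx.elim
  rw [ENNReal.tsum_mul_left]
  calc ENNReal.ofReal α * ∑' q, volume (U q)
      ≤ ENNReal.ofReal α * volume (ball y ((d + 2) * ρ)) := by
        gcongr
        exact (tsum_meas_le_meas_iUnion_of_disjoint volume hUm hUd).trans (measure_mono hUs)
    _ = _ := by
        rw [Measure.addHaar_ball_of_pos _ _ (by positivity), finrank_euclideanSpace_fin,
          mul_pow, ENNReal.ofReal_mul (by positivity), ENNReal.ofReal_mul hα.le]
        ring

end BadAbs

lemma fourier_finset_sum {d : ℕ} {ι : Type*} (s : Finset ι) {f : ι → Rd d → ℂ}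
    (hf : ∀ i ∈ s, Integrable (f i)) (ξ : Rd d) :
    𝓕 (fun x => ∑ i ∈ s, f i x) ξ = ∑ i ∈ s, 𝓕 (f i) ξ := by
  simp only [Real.fourier_eq, Finset.smul_sum]
  exact integral_finsetSum s fun i hi => (Real.fourierIntegral_convergent_iff ξ).2 (hf i hi)

lemma fourierInv_finset_sum {d : ℕ} {ι : Type*} (s : Finset ι) {f : ι → Rd d → ℂ}
    (hf : ∀ i ∈ s, Integrable (f i)) (x : Rd d) :
    𝓕⁻ (fun ξ => ∑ i ∈ s, f i ξ) x = ∑ i ∈ s, 𝓕⁻ (f i) x := by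
  simp only [Real.fourierInv_eq, Finset.smul_sum]
  refine integral_finsetSum s fun i hi => ?_
  simpa using (Real.fourierIntegral_convergent_iff (-x)).2 (hf i hi)

lemma fourier_eq_zero_of_not_integrable {d : ℕ} {f : Rd d → ℂ} (hf : ¬ Integrable f) :
    𝓕 f = 0 := by
  ext ξ
  rw [Real.fourier_eq]
  exact integral_undef fun h => hf ((Real.fourierIntegral_convergent_iff ξ).1 h)

lemma fourierInv_eq_zero_of_not_integrable {d : ℕ} {f : Rd d → ℂ} (hf : ¬ Integrable f) :
    𝓕⁻ f = 0 := by
  ext x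
  rw [Real.fourierInv_eq]
  refine integral_undef fun h => hf ((Real.fourierIntegral_convergent_iff (-x)).1 ?_)
  simpa using h

open Classical in
/-- The `L³` bound for a multiplier applied to finitely many functions, whose sum is controlled
in `L²` and `L⁴`. Functions which are not integrable contribute nothing. -/
lemma IsMultiplierFour.sum_fourierInv {d : ℕ} {A : ℝ} {m : Rd d → ℂ} (hm : IsMultiplierFour A m)
    (hm1 : ∀ ξ, ‖m ξ‖ ≤ 1) {ι : Type*} (J : Finset ι) {F : ι → Rd d → ℂ} {h : ι → Rd d → ℝ≥0∞}
    (hF : ∀ j x, ‖F j x‖ₑ ≤ h j x) {Q₂ Q₄ : ℝ≥0∞}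
    (h2 : ∫⁻ x, (∑ j ∈ J, h j x) ^ 2 ≤ Q₂) (hQ₂ : Q₂ ≠ ⊤)
    (h4 : ∫⁻ x, (∑ j ∈ J, h j x) ^ 4 ≤ Q₄) :
    Measurable (fun x => ∑ j ∈ J, 𝓕⁻ (fun ξ => m ξ * 𝓕 (F j) ξ) x) ∧
      ∫⁻ x, ‖∑ j ∈ J, 𝓕⁻ (fun ξ => m ξ * 𝓕 (F j) ξ) x‖ₑ ^ 3 ≤
        ENNReal.ofReal A ^ 2 * (Q₂ ^ (1 / 2 : ℝ) * Q₄ ^ (1 / 2 : ℝ)) := by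
  set s : Finset ι := {j ∈ J | Integrable (F j) ∧ Integrable fun ξ => m ξ * 𝓕 (F j) ξ} with hs
  set g : Rd d → ℂ := fun x => ∑ j ∈ s, F j x with hg
  have hsF : ∀ j ∈ s, Integrable (F j) := fun j hj => (Finset.mem_filter.1 hj).2.1
  have hsm : ∀ j ∈ s, Integrable fun ξ => m ξ * 𝓕 (F j) ξ :=
    fun j hj => (Finset.mem_filter.1 hj).2.2
  have hgi : Integrable g := integrable_finsetSum s hsF
  have hgm : (fun ξ => m ξ * 𝓕 g ξ) = fun ξ => ∑ j ∈ s, m ξ * 𝓕 (F j) ξ := by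
    ext ξ
    rw [hg, fourier_finset_sum s hsF, Finset.mul_sum]
  have hgmi : Integrable fun ξ => m ξ * 𝓕 g ξ := by
    rw [hgm]; exact integrable_finsetSum s hsm
  have hsum : (fun x => ∑ j ∈ J, 𝓕⁻ (fun ξ => m ξ * 𝓕 (F j) ξ) x) =
      𝓕⁻ fun ξ => m ξ * 𝓕 g ξ := by
    ext x
    rw [hgm, fourierInv_finset_sum s hsm]
    refine (Finset.sum_subset (Finset.filter_subset _ _) fun j hj hjs => ?_).symm
    have hn : ¬ (Integrable (F j) ∧ Integrable fun ξ => m ξ * 𝓕 (F j) ξ) :=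
      fun h => hjs (Finset.mem_filter.2 ⟨hj, h⟩)
    by_cases hi : Integrable (F j)
    · rw [fourierInv_eq_zero_of_not_integrable fun h => hn ⟨hi, h⟩, Pi.zero_apply]
    · simp [fourier_eq_zero_of_not_integrable hi, Real.fourierInv_eq]
  have hgb : ∀ x, ‖g x‖ₑ ≤ ∑ j ∈ J, h j x := fun x =>
    (enorm_sum_le _ _).trans ((Finset.sum_le_sum fun j _ => hF j x).trans
      (Finset.sum_le_sum_of_subset (Finset.filter_subset _ _)))
  have hg2 : ∫⁻ x, ‖g x‖ₑ ^ 2 ≤ Q₂ :=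
    (lintegral_mono fun x => by have := hgb x; gcongr).trans h2
  have hg4 : ∫⁻ x, ‖g x‖ₑ ^ 4 ≤ Q₄ :=
    (lintegral_mono fun x => by have := hgb x; gcongr).trans h4
  have hgL2 : MemLp g 2 := by
    refine ⟨hgi.1, ?_⟩
    have key : eLpNorm g 2 ^ 2 = ∫⁻ x, ‖g x‖ₑ ^ 2 := by
      simpa using eLpNorm_pow_eq_lintegral (μ := volume) g 2 (by norm_num)
    have : eLpNorm g 2 ^ 2 < ⊤ := key ▸ hg2.trans_lt hQ₂.lt_top
    exact (ENNReal.pow_lt_top_iff.1 this).resolve_right two_ne_zero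
  constructor
  · rw [hsum]; exact (continuous_fourierInv hgmi).measurable
  · have hpt := fun x => congrFun hsum x
    simp only [hpt]
    exact hm.lintegral_pow_three_le hm1 hgi hgL2 hgmi hg2 hg4

lemma enorm_tsum_pow_le_liminf {f : ℤ → ℂ} (k : ℕ) (hk : k ≠ 0) :
    ‖∑' j, f j‖ₑ ^ k ≤
      Filter.liminf (fun n : ℕ => ‖∑ j ∈ Finset.Icc (-(n:ℤ)) n, f j‖ₑ ^ k) Filter.atTop := by
  by_cases hf : Summable f
  · have h1 := hf.hasSum.comp Finset.tendsto_Icc_neg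
    have h2 := ((ENNReal.continuous_pow k).comp continuous_enorm).tendsto (∑' j, f j)
    exact (h2.comp h1).liminf_eq.ge
  · simp [tsum_eq_zero_of_not_summable hf, hk]

lemma lintegral_tsum_sub_fourierInv_pow_three_le {d : ℕ} {V : Type*} [Fintype V] {A : ℝ}
    {m : V → Rd d → ℂ} (hm : ∀ v, IsMultiplierFour A (m v)) (hm1 : ∀ v ξ, ‖m v ξ‖ ≤ 1)
    {F : ℤ → V → Rd d → ℂ} {h : ℤ → Rd d → ℝ≥0∞} (hh : ∀ j, Measurable (h j))
    (hF : ∀ j v x, ‖F j v x‖ₑ ≤ h j x) {Q₂ Q₃ Q₄ : ℝ≥0∞}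
    (h2 : ∀ n : ℕ, ∫⁻ x, (∑ j ∈ Finset.Icc (-(n:ℤ)) n, h j x) ^ 2 ≤ Q₂) (hQ₂ : Q₂ ≠ ⊤)
    (h3 : ∀ n : ℕ, ∫⁻ x, (∑ j ∈ Finset.Icc (-(n:ℤ)) n, h j x) ^ 3 ≤ Q₃)
    (h4 : ∀ n : ℕ, ∫⁻ x, (∑ j ∈ Finset.Icc (-(n:ℤ)) n, h j x) ^ 4 ≤ Q₄) :
    ∫⁻ x, ‖∑' j : ℤ, ∑ v, (F j v x - 𝓕⁻ (fun ξ => m v ξ * 𝓕 (F j v) ξ) x)‖ₑ ^ 3 ≤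
      (Fintype.card V) ^ 3 * (4 * (Q₃ +
        ENNReal.ofReal A ^ 2 * (Q₂ ^ (1 / 2 : ℝ) * Q₄ ^ (1 / 2 : ℝ)))) := by
  set H : ℕ → Rd d → ℝ≥0∞ := fun n x => ∑ j ∈ Finset.Icc (-(n:ℤ)) n, h j x with hH
  set u : ℕ → V → Rd d → ℂ := fun n v x =>
    ∑ j ∈ Finset.Icc (-(n:ℤ)) n, 𝓕⁻ (fun ξ => m v ξ * 𝓕 (F j v) ξ) x with hu
  have hHm : ∀ n, Measurable (H n) := fun n => Finset.measurable_sum _ fun j _ => hh j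
  have hu' : ∀ n v, Measurable (u n v) ∧ ∫⁻ x, ‖u n v x‖ₑ ^ 3 ≤
      ENNReal.ofReal A ^ 2 * (Q₂ ^ (1 / 2 : ℝ) * Q₄ ^ (1 / 2 : ℝ)) := fun n v =>
    (hm v).sum_fourierInv (hm1 v) _ (fun j x => hF j v x) (h2 n) hQ₂ (h4 n)
  set R : ℕ → Rd d → ℝ≥0∞ := fun n x =>
    (Fintype.card V) ^ 2 * ∑ v, 4 * (H n x ^ 3 + ‖u n v x‖ₑ ^ 3) with hR
  have hRm : ∀ n, Measurable (R n) := fun n => by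
    refine Measurable.const_mul (Finset.measurable_sum _ fun v _ => ?_) _
    exact (((hHm n).pow_const 3).add ((hu' n v).1.enorm.pow_const 3)).const_mul 4
  have hpt : ∀ (n : ℕ) x, ‖∑ j ∈ Finset.Icc (-(n:ℤ)) n,
      ∑ v, (F j v x - 𝓕⁻ (fun ξ => m v ξ * 𝓕 (F j v) ξ) x)‖ₑ ^ 3 ≤ R n x := by
    intro n x
    have e1 : ‖∑ j ∈ Finset.Icc (-(n:ℤ)) n,
        ∑ v, (F j v x - 𝓕⁻ (fun ξ => m v ξ * 𝓕 (F j v) ξ) x)‖ₑ ≤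
        ∑ v, (H n x + ‖u n v x‖ₑ) := by
      rw [Finset.sum_comm]
      refine (enorm_sum_le _ _).trans (Finset.sum_le_sum fun v _ => ?_)
      rw [Finset.sum_sub_distrib]
      refine enorm_sub_le.trans (add_le_add_left ?_ _)
      exact (enorm_sum_le _ _).trans (Finset.sum_le_sum fun j _ => hF j v x)
    have e2 := ENNReal.rpow_sum_le_const_mul_sum_rpow Finset.univ
      (fun v => H n x + ‖u n v x‖ₑ) (p := 3) (by norm_num)
    rw [Finset.card_univ, show (3:ℝ) - 1 = ((2:ℕ):ℝ) by norm_num,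
      ENNReal.rpow_natCast] at e2
    simp only [ENNReal.rpow_ofNat] at e2
    refine (pow_le_pow_left₀ zero_le e1 3).trans (e2.trans ?_)
    simp only [hR]
    gcongr with v
    have e3 := ENNReal.rpow_add_le_mul_rpow_add_rpow (H n x) ‖u n v x‖ₑ (p := 3) (by norm_num)
    rw [show (3:ℝ) - 1 = ((2:ℕ):ℝ) by norm_num, ENNReal.rpow_natCast] at e3
    simp only [ENNReal.rpow_ofNat] at e3
    refine e3.trans (le_of_eq ?_)
    norm_num
  calc _ ≤ ∫⁻ x, Filter.liminf (fun n => R n x) Filter.atTop := by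
        refine lintegral_mono fun x => (enorm_tsum_pow_le_liminf 3 (by norm_num)).trans ?_
        exact Filter.liminf_le_liminf (Filter.Eventually.of_forall fun n => hpt n x)
    _ ≤ Filter.liminf (fun n => ∫⁻ x, R n x) Filter.atTop := lintegral_liminf_le hRm
    _ ≤ _ := by
      refine Filter.liminf_le_of_le (by isBoundedDefault) fun a ha => ?_
      obtain ⟨n, hn⟩ := ha.exists
      refine hn.trans ?_
      simp only [hR]
      rw [lintegral_const_mul' _ _ (by finiteness), lintegral_finsetSum]
      · calc _ ≤ (Fintype.card V : ℝ≥0∞) ^ 2 * ∑ _v : V, 4 * (Q₃ +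
              ENNReal.ofReal A ^ 2 * (Q₂ ^ (1 / 2 : ℝ) * Q₄ ^ (1 / 2 : ℝ))) := by
              gcongr with v
              rw [lintegral_const_mul' _ _ (by finiteness),
                lintegral_add_left ((hHm n).pow_const 3)]
              gcongr
              · exact h3 n
              · exact (hu' n v).2
          _ = _ := by
            rw [Finset.sum_const, Finset.card_univ, nsmul_eq_mul]
            ring
      · exact fun v _ => (((hHm n).pow_const 3).add ((hu' n v).1.enorm.pow_const 3)).const_mul 4

lemma AdmissiblePhi.exists_bound {d : ℕ} {φ : Rd d → ℝ} (hφ : AdmissiblePhi d φ) :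
    ∃ c : ℝ, 0 < c ∧ ∀ x, |φ x| ≤ c := by
  have hK : HasCompactSupport φ := by
    refine (isCompact_closedBall (0 : Rd d) ((2:ℝ) ^ (-2 : ℤ))).of_isClosed_subset
      (isClosed_tsupport φ) fun x hx => ?_
    rw [mem_closedBall_zero_iff]
    exact (hφ.2.1 hx).2.le
  obtain ⟨c, hc⟩ := hK.exists_bound_of_continuous hφ.1.continuous
  exact ⟨max c 1, by positivity, fun x => (hc x).trans (le_max_left _ _)⟩

lemma enorm_Kv_le {d : ℕ} {φ Om : Rd d → ℝ} (hφ : AdmissiblePhi d φ) {c Mb : ℝ} (hc : 0 ≤ c)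
    (hφc : ∀ x, |φ x| ≤ c) (hMb : 0 ≤ Mb) (hOm : ∀ x : Rd d, x ≠ 0 → |Om x| ≤ Mb)
    (E : Set (Rd d)) (j : ℤ) (z : Rd d) :
    ‖Kv d φ Om E j z‖ₑ ≤ (ball (0 : Rd d) ((2:ℝ) ^ j)).indicator
      (fun _ => ENNReal.ofReal (c * Mb * 16 ^ d) * ENNReal.ofReal (((2:ℝ) ^ j) ^ d)⁻¹) z := by
  by_cases h0 : φ ((2:ℝ) ^ (-j) • z) = 0
  · rw [Kv, Kker, h0]
    simp
  have hs := hφ.2.1 (subset_tsupport φ h0)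
  have h2j : (0:ℝ) < (2:ℝ) ^ j := by positivity
  have hn : ‖(2:ℝ) ^ (-j) • z‖ = ((2:ℝ) ^ j)⁻¹ * ‖z‖ := by
    rw [norm_smul, zpow_neg, Real.norm_of_nonneg (by positivity)]
  rw [mem_ofPred_eq, hn] at hs
  have hlo : (2:ℝ) ^ j / 16 ≤ ‖z‖ := by
    have := mul_lt_mul_of_pos_left hs.1 h2j
    rw [mul_inv_cancel_left₀ h2j.ne'] at this
    norm_num at this
    linarith
  have hhi : ‖z‖ < (2:ℝ) ^ j := by
    have := mul_lt_mul_of_pos_left hs.2 h2j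
    rw [mul_inv_cancel_left₀ h2j.ne'] at this
    norm_num at this
    linarith
  have hz : 0 < ‖z‖ := lt_of_lt_of_le (by positivity) hlo
  rw [indicator_of_mem (mem_ball_zero_iff.2 hhi), ← ENNReal.ofReal_mul (by positivity),
    ← ofReal_norm]
  refine ENNReal.ofReal_le_ofReal ?_
  have hind : ‖indicator E (fun _ => (1:ℝ)) (‖z‖⁻¹ • z)‖ ≤ 1 := by
    refine (norm_indicator_le_norm_self _ _).trans ?_
    simp
  have hpow : ‖z‖ ^ (-(d:ℤ)) ≤ 16 ^ d * (((2:ℝ) ^ j) ^ d)⁻¹ := by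
    rw [zpow_neg, zpow_natCast]
    calc (‖z‖ ^ d)⁻¹ ≤ (((2:ℝ) ^ j / 16) ^ d)⁻¹ := by gcongr
      _ = _ := by rw [div_pow, inv_div]; ring
  rw [Kv, Kker, norm_mul, norm_mul, norm_mul, Real.norm_eq_abs, Real.norm_eq_abs,
    Real.norm_of_nonneg (by positivity : 0 ≤ ‖z‖ ^ (-(d:ℤ)))]
  calc _ ≤ c * Mb * (16 ^ d * (((2:ℝ) ^ j) ^ d)⁻¹) * 1 := by
        gcongr
        · exact hφc _
        · exact hOm z (norm_pos_iff.1 hz)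
    _ = _ := by ring

lemma enorm_Tjv_le {d : ℕ} {φ Om : Rd d → ℝ} (hφ : AdmissiblePhi d φ) {c Mb : ℝ} (hc : 0 ≤ c)
    (hφc : ∀ x, |φ x| ≤ c) (hMb : 0 ≤ Mb) (hOm : ∀ x : Rd d, x ≠ 0 → |Om x| ≤ Mb)
    (E : Set (Rd d)) (j : ℤ) {g : Rd d → ℝ} {β : Rd d → ℝ≥0∞} (hβ : Measurable β)
    (hg : ∀ᵐ y, ‖g y‖ₑ ≤ β y) (x : Rd d) :
    ‖Tjv d φ Om E j g x‖ₑ ≤ ENNReal.ofReal (c * Mb * 16 ^ d) * ballMean d ((2:ℝ) ^ j) β x := by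
  refine (enorm_integral_le_lintegral_enorm _).trans ?_
  rw [ballMean, ← mul_assoc, ← lintegral_indicator measurableSet_ball,
    ← lintegral_const_mul _ (hβ.indicator measurableSet_ball)]
  refine lintegral_mono_ae ?_
  filter_upwards [hg] with y hy
  rw [enorm_mul]
  refine (mul_le_mul' (enorm_Kv_le hφ hc hφc hMb hOm E j (x - y)) hy).trans ?_
  by_cases h : y ∈ ball x ((2:ℝ) ^ j)
  · have h' : x - y ∈ ball (0 : Rd d) ((2:ℝ) ^ j) := by
      rwa [mem_ball_zero_iff, ← dist_eq_norm, ← mem_ball']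
    rw [indicator_of_mem h, indicator_of_mem h']
  · have h' : x - y ∉ ball (0 : Rd d) ((2:ℝ) ^ j) := by
      rwa [mem_ball_zero_iff, ← dist_eq_norm, ← mem_ball']
    rw [indicator_of_notMem h, indicator_of_notMem h']
    simp

lemma sum_Icc_neg_eq_sum_range {M : Type*} [AddCommMonoid M] (f : ℤ → M) (n : ℕ) :
    ∑ j ∈ Finset.Icc (-(n:ℤ)) n, f j = ∑ i ∈ Finset.range (2 * n + 1), f (-n + i) := by
  refine Finset.sum_nbij' (fun j => (j + n).toNat) (fun i => -n + i) ?_ ?_ ?_ ?_ ?_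
  · intro j hj; simp only [Finset.mem_Icc, Finset.mem_range] at *; omega
  · intro i hi; simp only [Finset.mem_Icc, Finset.mem_range] at *; omega
  · intro j hj; simp only [Finset.mem_Icc] at *; omega
  · intro i hi; omega
  · intro j hj
    simp only [Finset.mem_Icc] at hj
    congr 1
    omega

/-- Moments of the sum of the ball means of the bad functions. -/
lemma BadFam.lintegral_sum_ballMean_pow_le {d : ℕ} {Qset : Set (ℤ × (Fin d → ℤ))}
    {b : ℤ × (Fin d → ℤ) → Rd d → ℝ} {α : ℝ} (hb : BadFam d Qset b α) (hα : 0 < α)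
    {β : ℤ → Rd d → ℝ≥0∞} (hβ : ∀ m, Measurable (β m)) (hβb : ∀ m, badAbs Qset b m =ᵐ[volume] β m)
    (s : ℕ) (p n : ℕ) :
    ∫⁻ x, (∑ j ∈ Finset.Icc (-(n:ℤ)) n, ballMean d ((2:ℝ) ^ j) (β (j - s)) x) ^ (p + 1) ≤
      ((p + 1).factorial * (ENNReal.ofReal (α * (d + 2) ^ d) * volume (ball (0 : Rd d) 1)) ^ p *
        volume (ball (0 : Rd d) 1)) * ∑' q : Qset, ENNReal.ofReal (∫ x, |b q.1 x|) := by
  set r : ℕ → ℝ := fun i => (2:ℝ) ^ (-(n:ℤ) + i) with hr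
  have hr0 : ∀ i, 0 < r i := fun i => by simp only [hr]; positivity
  have hrm : Monotone r := fun i k hik => by
    simp only [hr]
    exact zpow_le_zpow_right₀ (by norm_num) (by omega)
  have hinj : Function.Injective fun i : ℕ => -(n:ℤ) + i - s := fun i k h => by
    simp only at h; omega
  have hsum : ∀ (k : ℕ) (S : Set (Rd d)), ∑ i ∈ Finset.range k, ∫⁻ z in S, β (-n + i - s) z =
      ∑ m ∈ (Finset.range k).image fun i : ℕ => -(n:ℤ) + i - s,
        ∫⁻ z in S, badAbs Qset b m z := fun k S => by
    rw [Finset.sum_image fun i _ k _ h => hinj h]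
    refine Finset.sum_congr rfl fun i _ => ?_
    exact lintegral_congr_ae (ae_restrict_of_ae ((hβb _).mono fun x hx => hx.symm))
  have key := lintegral_ballMeanSum_pow_succ_le (r := r) (β := fun i => β (-n + i - s))
    (D := ENNReal.ofReal (α * (d + 2) ^ d) * volume (ball (0 : Rd d) 1)) hr0 hrm
    (fun i => hβ _) (fun k y => by
      rw [hsum]
      refine hb.sum_setLIntegral_ball_badAbs_le hα (hr0 k) _ (fun m hm => ?_) y
      obtain ⟨i, hi, rfl⟩ := Finset.mem_image.1 hm
      rw [Finset.mem_range] at hi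
      exact zpow_le_zpow_right₀ (by norm_num) (by omega)) p (2 * n + 1)
  have hS := hsum (2 * n + 1) univ
  simp only [setLIntegral_univ] at hS
  rw [hS] at key
  refine le_trans (le_of_eq ?_) (key.trans ?_)
  · congr 1 with x
    rw [sum_Icc_neg_eq_sum_range]
    rfl
  · gcongr
    exact hb.sum_lintegral_badAbs_le _

lemma card_le_of_separated {d : ℕ} {V : Type*} [Fintype V] {e : V → Rd d} {ρ : ℝ} (hρ : 0 < ρ)
    (hρ1 : ρ ≤ 2) (he : ∀ v, ‖e v‖ = 1) (hsep : ∀ v v', v ≠ v' → ρ ≤ ‖e v - e v'‖) :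
    (Fintype.card V : ℝ) ≤ (4 / ρ) ^ d := by
  have hdisj : Pairwise (Function.onFun Disjoint fun v => ball (e v) (ρ / 2)) := by
    intro v v' hne
    refine ball_disjoint_ball ?_
    rw [add_halves, dist_eq_norm]
    exact hsep v v' hne
  have hsub : ⋃ v, ball (e v) (ρ / 2) ⊆ ball (0 : Rd d) 2 := by
    refine iUnion_subset fun v => ball_subset_ball' ?_
    rw [dist_zero_right, he]
    linarith
  have h := (tsum_meas_le_meas_iUnion_of_disjoint volume
    (fun v => measurableSet_ball) hdisj).trans (measure_mono hsub)
  simp only [tsum_fintype, Measure.addHaar_ball_of_pos _ _ (half_pos hρ),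
    Measure.addHaar_ball_of_pos _ (0 : Rd d) (two_pos : (0:ℝ) < 2), finrank_euclideanSpace_fin,
    Finset.sum_const, Finset.card_univ, nsmul_eq_mul, ← mul_assoc] at h
  have hω : volume (ball (0 : Rd d) 1) ≠ 0 := (measure_ball_pos volume _ one_pos).ne'
  rw [ENNReal.mul_le_mul_iff_left hω measure_ball_lt_top.ne, ← ENNReal.ofReal_natCast,
    ← ENNReal.ofReal_mul (by positivity), ENNReal.ofReal_le_ofReal_iff (by positivity)] at h
  calc (Fintype.card V : ℝ) ≤ 2 ^ d / (ρ / 2) ^ d := (le_div_iff₀ (by positivity)).2 h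
    _ = _ := by rw [← div_pow]; congr 1; field_simp; norm_num

lemma MicroFamily.card_le {d s : ℕ} {γ : ℝ} (hγ : 0 < γ) {V : Type} [Fintype V] {e : V → Rd d}
    {E : V → Set (Rd d)} (h : MicroFamily d γ s e E) (hd : 1 ≤ d) :
    (Fintype.card V : ℝ) ≤
      64 ^ d * (2:ℝ) ^ ((s:ℝ) * γ * ((2/3) * ((d:ℝ) - 1) + (d / 2 : ℕ) + 1)) := by
  have hsγ : 0 ≤ (s:ℝ) * γ := by positivity
  have h2 : (0:ℝ) < 2 := two_pos
  have hle1 : (2:ℝ) ^ (-(s:ℝ) * γ - 4) ≤ 2 := by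
    calc _ ≤ (2:ℝ) ^ (1:ℝ) := Real.rpow_le_rpow_of_exponent_le (by norm_num) (by linarith)
      _ = 2 := Real.rpow_one 2
  refine (card_le_of_separated (Real.rpow_pos_of_pos h2 _) hle1 h.1 h.2.1).trans ?_
  have e1 : 4 / (2:ℝ) ^ (-(s:ℝ) * γ - 4) = 64 * (2:ℝ) ^ ((s:ℝ) * γ) := by
    rw [Real.rpow_sub h2, neg_mul, Real.rpow_neg h2.le]
    norm_num
    field_simp
    norm_num
  rw [e1, mul_pow, ← Real.rpow_natCast ((2:ℝ) ^ _), ← Real.rpow_mul h2.le]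
  gcongr
  · norm_num
  · have h3 : (d:ℝ) ≤ 2 * ((d / 2 : ℕ) : ℝ) + 1 := by
      exact_mod_cast (by omega : d ≤ 2 * (d / 2) + 1)
    have h4 : (1:ℝ) ≤ d := by exact_mod_cast hd
    linarith

/-- `L³` estimate with trivial bound in `s` for `Σ_j Σ_v (I - G_v^s) T_j^v 𝔅_{j-s}`. -/
theorem I_sub_Gv_Tjv_l3_bound :
    ∀ d : ℕ, 2 ≤ d →
    ∀ φ : Rd d → ℝ, AdmissiblePhi d φ →
    ∀ Φ : ℝ → ℝ, CutoffHyp Φ →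
    ∃ C : ℝ, 0 < C ∧
      ∀ γ : ℝ, 0 < γ → γ < 1 →
      ∀ s : ℕ, 200 ≤ s →
      ∀ (V : Type) (_ : Fintype V) (e : V → Rd d) (E : V → Set (Rd d)),
        MicroFamily d γ s e E →
      ∀ (Om : Rd d → ℝ) (Mb : ℝ), Homogeneous0 d Om →
        (∀ x : Rd d, x ≠ 0 → |Om x| ≤ Mb) →
      ∀ (Qset : Set (ℤ × (Fin d → ℤ))) (b : ℤ × (Fin d → ℤ) → Rd d → ℝ) (α : ℝ),
        0 < α → BadFam d Qset b α →
        eLpNorm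
          (fun x : Rd d => ∑' j : ℤ, ∑ v : V,
            (((Tjv d φ Om (E v) j (bsum d Qset b (j - (s:ℤ))) x : ℝ) : ℂ) -
              Gop d Φ γ s (e v)
                (fun y => ((Tjv d φ Om (E v) j (bsum d Qset b (j - (s:ℤ))) y : ℝ) : ℂ)) x))
          3 volume ≤
        ENNReal.ofReal
            (C * (2:ℝ) ^ ((s:ℝ) * γ * ((2/3) * ((d:ℝ) - 1) + (d / 2 : ℕ) + 1)) * Mb) *
          (ENNReal.ofReal (α^2) *
            ∑' q : Qset, ENNReal.ofReal (∫ x : Rd d, |b q.1 x|)) ^ ((1:ℝ)/3) := by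
  intro d hd φ hφ Φ hΦ
  obtain ⟨A, hA⟩ := exists_isMultiplierFour_symbol (d := d) hΦ (by omega)
  obtain ⟨c, hc, hφc⟩ := hφ.exists_bound
  set ω : ℝ := (volume (ball (0 : Rd d) 1)).toReal with hω
  have hωv : volume (ball (0 : Rd d) 1) = ENNReal.ofReal ω :=
    (ENNReal.ofReal_toReal measure_ball_lt_top.ne).symm
  have hω0 : 0 ≤ ω := ENNReal.toReal_nonneg
  have hA0 : 0 ≤ A := (hA 0).nonneg
  set X : ℝ := 96 * (1 + A ^ 2) * ((d + 2) ^ d) ^ 2 * ω ^ 3 with hX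
  have hX0 : 0 ≤ X := by positivity
  refine ⟨64 ^ d * (c * 16 ^ d) * (X + 1), by positivity, ?_⟩
  intro γ hγ _ s _ V _ e E hE Om Mb _ hOm Qset b α hα hb
  have hMb : 0 ≤ Mb := by
    have : Nonempty (Fin d) := ⟨⟨0, by omega⟩⟩
    obtain ⟨x, hx⟩ := exists_ne (0 : Rd d)
    exact (abs_nonneg _).trans (hOm x hx)
  set lam : ℝ := (2:ℝ) ^ ((s:ℝ) * γ * ((2/3) * ((d:ℝ) - 1) + (d / 2 : ℕ) + 1)) with hlam
  have hlam0 : 0 < lam := Real.rpow_pos_of_pos two_pos _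
  have hcard : (Fintype.card V : ℝ) ≤ 64 ^ d * lam := hE.card_le hγ (by omega)
  set B : ℝ≥0∞ := ∑' q : Qset, ENNReal.ofReal (∫ x : Rd d, |b q.1 x|) with hB
  set k : ℝ := c * Mb * 16 ^ d with hk
  have hk0 : 0 ≤ k := by positivity
  by_cases hKB : ENNReal.ofReal k * B = ⊤
  · obtain ⟨hk', hB'⟩ | ⟨hk', -⟩ := ENNReal.mul_eq_top.1 hKB
    · have hMb' : 0 < Mb := by
        refine hMb.lt_of_ne fun h => hk' ?_
        rw [hk, ← h]; simp
      have h1 : ENNReal.ofReal (64 ^ d * (c * 16 ^ d) * (X + 1) * lam * Mb) ≠ 0 := by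
        rw [ne_eq, ENNReal.ofReal_eq_zero, not_le]
        positivity
      have h2 : ENNReal.ofReal (α ^ 2) ≠ 0 := by
        rw [ne_eq, ENNReal.ofReal_eq_zero, not_le]
        positivity
      rw [hB', ENNReal.mul_top h2, ENNReal.top_rpow_of_pos (by norm_num), ENNReal.mul_top h1]
      exact le_top
    · exact absurd hk' ENNReal.ofReal_ne_top
  set K : ℝ≥0∞ := ENNReal.ofReal k with hK
  set D : ℝ≥0∞ := ENNReal.ofReal (α * (d + 2) ^ d) * ENNReal.ofReal ω with hD
  set W : ℝ≥0∞ := ENNReal.ofReal ω with hW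
  have hβe : ∀ m, ∃ β : Rd d → ℝ≥0∞, Measurable β ∧ badAbs Qset b m =ᵐ[volume] β :=
    fun m => ⟨_, (hb.aemeasurable_badAbs m).measurable_mk, (hb.aemeasurable_badAbs m).ae_eq_mk⟩
  choose β hβ hβb using hβe
  set h : ℤ → Rd d → ℝ≥0∞ := fun j x => K * ballMean d ((2:ℝ) ^ j) (β (j - s)) x with hh
  have hhm : ∀ j, Measurable (h j) := fun j => (measurable_ballMean _ (hβ _)).const_mul K
  have hmom : ∀ (p n : ℕ), ∫⁻ x, (∑ j ∈ Finset.Icc (-(n:ℤ)) n, h j x) ^ (p + 1) ≤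
      K ^ (p + 1) * (((p + 1).factorial * D ^ p * W) * B) := fun p n => by
    have h1 := hb.lintegral_sum_ballMean_pow_le hα hβ hβb s p n
    rw [hωv] at h1
    refine le_trans (le_of_eq ?_) (mul_le_mul_right h1 (K ^ (p + 1)))
    rw [← lintegral_const_mul' _ _ (by finiteness)]
    congr 1 with x
    rw [← mul_pow, Finset.mul_sum]
  set Q₃ : ℝ≥0∞ := 24 * K ^ 3 * D ^ 2 * W * B with hQ₃
  set Q₂ : ℝ≥0∞ := 24 * K ^ 2 * D * W * B with hQ₂
  set Q₄ : ℝ≥0∞ := 24 * K ^ 4 * D ^ 3 * W * B with hQ₄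
  have b2 : ∀ n : ℕ, ∫⁻ x, (∑ j ∈ Finset.Icc (-(n:ℤ)) n, h j x) ^ 2 ≤ Q₂ := fun n => by
    refine (hmom 1 n).trans ?_
    calc _ = 2 * (K ^ 2 * D * W * B) := by norm_num [Nat.factorial]; ring
      _ ≤ 24 * (K ^ 2 * D * W * B) := by gcongr; norm_num
      _ = _ := by rw [hQ₂]; ring
  have b3 : ∀ n : ℕ, ∫⁻ x, (∑ j ∈ Finset.Icc (-(n:ℤ)) n, h j x) ^ 3 ≤ Q₃ := fun n => by
    refine (hmom 2 n).trans ?_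
    calc _ = 6 * (K ^ 3 * D ^ 2 * W * B) := by norm_num [Nat.factorial]; ring
      _ ≤ 24 * (K ^ 3 * D ^ 2 * W * B) := by gcongr; norm_num
      _ = _ := by rw [hQ₃]; ring
  have b4 : ∀ n : ℕ, ∫⁻ x, (∑ j ∈ Finset.Icc (-(n:ℤ)) n, h j x) ^ 4 ≤ Q₄ := fun n => by
    refine (hmom 3 n).trans (le_of_eq ?_)
    norm_num [Nat.factorial, hQ₄]; ring
  have hQ₂t : Q₂ ≠ ⊤ := by
    have : Q₂ = 24 * K * D * W * (K * B) := by rw [hQ₂]; ring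
    rw [this]
    exact ENNReal.mul_ne_top (by finiteness) hKB
  have hgeo : Q₂ ^ (1 / 2 : ℝ) * Q₄ ^ (1 / 2 : ℝ) = Q₃ := by
    rw [← ENNReal.mul_rpow_of_nonneg _ _ (by norm_num), show Q₂ * Q₄ = Q₃ ^ 2 by
      rw [hQ₂, hQ₃, hQ₄]; ring, ← ENNReal.rpow_natCast, ← ENNReal.rpow_mul]
    norm_num
  have hgoal := lintegral_tsum_sub_fourierInv_pow_three_le (V := V) (A := A)
    (m := fun v ξ => (Φ ((2:ℝ) ^ (γ * s) * ⟪e v, ‖ξ‖⁻¹ • ξ⟫) : ℂ))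
    (fun v => by simpa only [real_inner_smul_left] using hA ((2:ℝ) ^ (γ * s) • e v))
    (fun v ξ => by
      rw [Complex.norm_real, Real.norm_of_nonneg (hΦ.2.1 _).1]
      exact (hΦ.2.1 _).2)
    (F := fun j v y => ((Tjv d φ Om (E v) j (bsum d Qset b (j - (s:ℤ))) y : ℝ) : ℂ))
    hhm (fun j v x => by
      rw [← ofReal_norm, Complex.norm_real, ofReal_norm]
      refine enorm_Tjv_le hφ hc.le hφc hMb hOm (E v) j (hβ _) ?_ x
      filter_upwards [hβb (j - s)] with y hy
      exact (enorm_bsum_le _ y).trans hy.le)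
    b2 hQ₂t b3 b4
  rw [hgeo] at hgoal
  have hcube (f : Rd d → ℂ) : eLpNorm f 3 ^ 3 = ∫⁻ x, ‖f x‖ₑ ^ 3 := by
    simpa using eLpNorm_pow_eq_lintegral (μ := volume) f 3 (by norm_num)
  refine (ENNReal.pow_le_pow_left_iff (n := 3) (by norm_num)).1 ?_
  rw [hcube]
  refine hgoal.trans ?_
  have hcard' : (Fintype.card V : ℝ≥0∞) ≤ ENNReal.ofReal (64 ^ d * lam) := by
    rw [← ENNReal.ofReal_natCast]
    exact ENNReal.ofReal_le_ofReal hcard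
  have hX1 : X ≤ (X + 1) ^ 3 := by nlinarith [sq_nonneg X, pow_nonneg hX0 3]
  have hroot : ((ENNReal.ofReal (α ^ 2) * B) ^ ((1:ℝ) / 3)) ^ 3 = ENNReal.ofReal (α ^ 2) * B := by
    rw [← ENNReal.rpow_natCast, ← ENNReal.rpow_mul]
    norm_num
  rw [mul_pow, hroot, ← mul_assoc (_ ^ 3) _ B,
    ← ENNReal.ofReal_pow (show 0 ≤ 64 ^ d * (c * 16 ^ d) * (X + 1) * lam * Mb by positivity),
    ← ENNReal.ofReal_mul (pow_nonneg
      (show 0 ≤ 64 ^ d * (c * 16 ^ d) * (X + 1) * lam * Mb by positivity) 3)]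
  calc (Fintype.card V : ℝ≥0∞) ^ 3 * (4 * (Q₃ + ENNReal.ofReal A ^ 2 * Q₃))
      ≤ ENNReal.ofReal (64 ^ d * lam) ^ 3 * (4 * (Q₃ + ENNReal.ofReal A ^ 2 * Q₃)) := by gcongr
    _ = ENNReal.ofReal ((64 ^ d * lam) ^ 3 * k ^ 3 * X * α ^ 2) * B := by
      have e4 : (4 : ℝ≥0∞) = ENNReal.ofReal 4 := by simp
      have e24 : (24 : ℝ≥0∞) = ENNReal.ofReal 24 := by simp
      have e1 : (1 : ℝ≥0∞) = ENNReal.ofReal 1 := by simp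
      have e0 : Q₃ + ENNReal.ofReal A ^ 2 * Q₃ = (1 + ENNReal.ofReal A ^ 2) * Q₃ := by ring
      rw [e0, hQ₃, hD, hK, hW, e4, e24, e1, ← ENNReal.ofReal_pow hA0,
        ← ENNReal.ofReal_add (by positivity) (by positivity), ← ENNReal.ofReal_pow hk0,
        ← ENNReal.ofReal_mul (by positivity : 0 ≤ α * ((d:ℝ) + 2) ^ d),
        ← ENNReal.ofReal_pow (by positivity), ← ENNReal.ofReal_mul (by positivity),
        ← ENNReal.ofReal_pow (by positivity), ← ENNReal.ofReal_mul (by positivity),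
        ← ENNReal.ofReal_mul (by positivity), ← mul_assoc, ← mul_assoc, ← mul_assoc,
        ← ENNReal.ofReal_mul (by positivity), ← ENNReal.ofReal_mul (by positivity),
        ← ENNReal.ofReal_mul (by positivity)]
      congr 2
      rw [hX]
      ring
    _ ≤ _ := by
      gcongr
      calc (64 ^ d * lam) ^ 3 * k ^ 3 * X
          ≤ (64 ^ d * lam) ^ 3 * k ^ 3 * (X + 1) ^ 3 := by gcongr
        _ = _ := by rw [hk]; ring
end
end

section
/- With the Calderón–Zygmund decomposition as in the context, fix an integer s ≥ 200 and w ∈ {0,1/2}^d. Then there is a constant C' depending only on d and the constants C, c₁, c₂ such that for every measurable set A ⊆ ℝ^d, Σ |K| ≤ C' 2^{ds} |A|, where the sum runs over all K ∈ 𝔇^w with K ⊆ A such that b_{k−s}·χ_{½K} is not almost everywhere zero, and k = k(K) is the integer with l(K) = 2^k. -/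
open MeasureTheory Metric Set FourierTransform
open scoped ENNReal RealInnerProductSpace

noncomputable section

theorem dcube_eq_preimage (d : ℕ) (w : Fin d → ℝ) (k : ℤ) (m : Fin d → ℤ) :
    dcube d w k m = (MeasurableEquiv.toLp 2 (Fin d → ℝ)).symm ⁻¹'
      (Set.univ.pi fun i => Ico ((2:ℝ) ^ k * (w i + m i)) ((2:ℝ) ^ k * (w i + m i + 1))) := by
  ext x
  simp [dcube]

theorem measurableSet_dcube (d : ℕ) (w : Fin d → ℝ) (k : ℤ) (m : Fin d → ℤ) :
    MeasurableSet (dcube d w k m) := by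
  rw [dcube_eq_preimage]
  exact (MeasurableEquiv.measurable _)
    (MeasurableSet.univ_pi fun _ => measurableSet_Ico)

theorem volume_dcube_s12 (d : ℕ) (w : Fin d → ℝ) (k : ℤ) (m : Fin d → ℤ) :
    volume (dcube d w k m) = ENNReal.ofReal ((2:ℝ) ^ k) ^ d := by
  rw [dcube_eq_preimage, (EuclideanSpace.volume_preserving_symm_measurableEquiv_toLp
    (Fin d)).measure_preimage
    (MeasurableSet.univ_pi fun _ => measurableSet_Ico).nullMeasurableSet, Real.volume_pi_Ico]
  have h (i : Fin d) : (2:ℝ) ^ k * (w i + m i + 1) - (2:ℝ) ^ k * (w i + m i) = (2:ℝ) ^ k := by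
    ring
  simp [h]

theorem volume_dcube_eq_mul (d s : ℕ) (w w' : Fin d → ℝ) (k : ℤ) (m m' : Fin d → ℤ) :
    volume (dcube d w k m) =
      ENNReal.ofReal ((2:ℝ) ^ (d * s)) * volume (dcube d w' (k - s) m') := by
  have h : (2:ℝ) ^ k = 2 ^ s * 2 ^ (k - (s : ℤ)) := by
    rw [← zpow_natCast, ← zpow_add₀ two_ne_zero]
    congr 1
    ring
  rw [volume_dcube_s12, volume_dcube_s12, h, ENNReal.ofReal_mul (by positivity), mul_pow,
    ← ENNReal.ofReal_pow (by positivity) d, ← pow_mul, mul_comm s d]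

/-- Two cubes of the same grid and the same generation that share a point coincide. -/
theorem index_eq_of_mem_dcube {d : ℕ} {w : Fin d → ℝ} {k : ℤ} {m m' : Fin d → ℤ} {x : Rd d}
    (h : x ∈ dcube d w k m) (h' : x ∈ dcube d w k m') : m = m' := by
  have key {n n' : Fin d → ℤ} (hn : x ∈ dcube d w k n) (hn' : x ∈ dcube d w k n') (i : Fin d) :
      n i ≤ n' i := by
    have h1 := (hn i).1.trans_lt (hn' i).2
    have h2 := lt_of_mul_lt_mul_left h1 (by positivity)
    have h3 : (n i : ℝ) < n' i + 1 := by linarith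
    exact Int.lt_add_one_iff.mp (by exact_mod_cast h3)
  exact funext fun i => le_antisymm (key h h' i) (key h' h i)

/-- A cube at least four times smaller than `K` that meets `½K` lies inside `K`. -/
theorem dcube_subset_of_mem_dhalf {d s : ℕ} (hs : 2 ≤ s) {w w' : Fin d → ℝ} {k : ℤ}
    {m m' : Fin d → ℤ} {x : Rd d} (hx : x ∈ dhalf d w k m)
    (hx' : x ∈ dcube d w' (k - s) m') : dcube d w' (k - s) m' ⊆ dcube d w k m := by
  intro y hy i
  have h : (2:ℝ) ^ (k - (s : ℤ)) ≤ 2 ^ k * (1 / 4) := by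
    calc (2:ℝ) ^ (k - (s : ℤ)) ≤ 2 ^ (k - 2) := zpow_le_zpow_right₀ one_le_two (by omega)
      _ = 2 ^ k * (1 / 4) := by rw [zpow_sub₀ two_ne_zero]; norm_num; ring
  have h1 := hx i
  have h2 := hx' i
  have h3 := hy i
  constructor <;> nlinarith

/-- If `b_m χ_{½K}` does not vanish almost everywhere, some selected cube of side `2^m`
meets `½K`. -/
theorem exists_mem_dhalf_of_not_ae_zero {d : ℕ} {Qset : Set (ℤ × (Fin d → ℤ))}
    {b : ℤ × (Fin d → ℤ) → Rd d → ℝ}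
    (hb : ∀ q ∈ Qset, Function.support (b q) ⊆ dcube d 0 q.1 q.2)
    {w : Fin d → ℝ} {k n : ℤ} {m : Fin d → ℤ}
    (h : ¬ ((dhalf d w k m).indicator (bsum d Qset b n)
      =ᵐ[(volume : Measure (Rd d))] (fun _ => (0:ℝ)))) :
    ∃ v : Fin d → ℤ, (n, v) ∈ Qset ∧ ∃ x ∈ dhalf d w k m, x ∈ dcube d 0 n v := by
  contrapose! h
  refine Filter.Eventually.of_forall fun x => ?_
  refine Set.indicator_apply_eq_zero.mpr fun hx => ?_
  have hz (v : Fin d → ℤ) : Set.indicator Qset (fun q => b q x) (n, v) = 0 := by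
    refine Set.indicator_apply_eq_zero.mpr fun hv => ?_
    by_contra hne
    exact h v hv x hx (hb _ hv hne)
  simp [bsum, hz]

/-- Carleson measure type estimate: `Σ_{K ⊆ A, b_{k-s}χ_{½K} ≠ 0} |K| ≲ 2^{ds}|A|`. -/
theorem carleson_type_estimate :
    ∀ d : ℕ, 2 ≤ d →
    ∀ Cc c₁ c₂ : ℝ, 0 < Cc → 0 < c₁ → 0 < c₂ →
    ∃ C' : ℝ, 0 < C' ∧
      ∀ COm : ℝ, 0 < COm →
      ∀ f : Rd d → ℝ, Integrable f →
      ∀ lam : ℝ, 0 < lam →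
      ∀ (Qset : Set (ℤ × (Fin d → ℤ))) (b : ℤ × (Fin d → ℤ) → Rd d → ℝ),
        CZData d COm Cc c₁ c₂ f lam Qset b →
      ∀ s : ℕ, 200 ≤ s →
      ∀ w : Fin d → ℝ, GridShift d w →
      ∀ A : Set (Rd d), MeasurableSet A →
        (∑' K : {km : ℤ × (Fin d → ℤ) //
            dcube d w km.1 km.2 ⊆ A ∧
            ¬ ((dhalf d w km.1 km.2).indicator (bsum d Qset b (km.1 - (s : ℤ)))
                =ᵐ[(volume : Measure (Rd d))] (fun _ => (0:ℝ)))},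
          volume (dcube d w K.1.1 K.1.2)) ≤
        ENNReal.ofReal (C' * (2:ℝ) ^ (d * s)) * volume A := by
  intro d _ Cc c₁ c₂ _ _ _
  refine ⟨1, one_pos, ?_⟩
  intro COm _ f _ lam _ Qset b hCZ s hs w _ A _
  have hex (K : {km : ℤ × (Fin d → ℤ) // dcube d w km.1 km.2 ⊆ A ∧
      ¬ ((dhalf d w km.1 km.2).indicator (bsum d Qset b (km.1 - (s : ℤ)))
        =ᵐ[(volume : Measure (Rd d))] (fun _ => (0:ℝ)))}) :=
    exists_mem_dhalf_of_not_ae_zero hCZ.support_subset K.2.2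
  choose v hv p hp hp' using hex
  have hsub K : dcube d 0 (K.1.1 - s) (v K) ⊆ dcube d w K.1.1 K.1.2 :=
    dcube_subset_of_mem_dhalf (by omega) (hp K) (hp' K)
  have hdisj : Pairwise (Function.onFun Disjoint fun K => dcube d 0 (K.1.1 - s) (v K)) := by
    intro K K' hne
    refine hCZ.pairwise_disjoint (hv K) (hv K') fun heq => hne ?_
    obtain ⟨h1, h2⟩ := Prod.mk.inj heq
    have hk : K.1.1 = K'.1.1 := by omega
    have hx : p K ∈ dcube d w K.1.1 K'.1.2 := by
      rw [hk]
      apply hsub K'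
      rw [← h1, ← h2]
      exact hp' K
    exact Subtype.ext (Prod.ext hk (index_eq_of_mem_dcube (hsub K (hp' K)) hx))
  rw [one_mul, tsum_congr fun K => volume_dcube_eq_mul d s w 0 K.1.1 K.1.2 (v K),
    ENNReal.tsum_mul_left, ← measure_iUnion hdisj fun _ => measurableSet_dcube ..]
  gcongr
  exact Set.iUnion_subset fun K => (hsub K).trans K.2.1
end
end
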